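/- arXiv:2411.05941 — 3 statements merged into one kernel-verified Lean document; each statement's English description precedes it below -/
import Mathlib

section
/- For every positive integer n with n ≡ 3 (mod 8), the sum Σ over pairs of positive integers (m₁,m₂) with m₁²+2m₂² = n of χ_{−4}(m₁)·m₁ equals 0 if and only if there exists a prime p with p ≡ 5 (mod 8) or p ≡ 7 (mod 8) such that ord_p(n) is odd. -/
open Finset

/-- The quadratic character modulo 4. -/
def χm4 (m : ℕ) : ℤ := if m % 4 = 1 then 1 else if m % 4 = 3 then -1 else 0

namespace G6

def chi (x : ℤ) : ℤ := if x % 4 = 1 then 1 else if x % 4 = 3 then -1 else 0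

noncomputable def eps (a : ℤ√(-2)) : ℂ := (chi a.re : ℂ) * (if a.im % 2 = 0 then 1 else Complex.I)

noncomputable def w : ℂ := (Real.sqrt 2 : ℝ) * Complex.I

lemma w_sq : w * w = -2 := by
  have h : ((Real.sqrt 2 : ℝ) : ℂ) * (Real.sqrt 2 : ℝ) = 2 := by
    rw [← Complex.ofReal_mul, Real.mul_self_sqrt (by norm_num)]; norm_num
  unfold w
  linear_combination (Complex.I * Complex.I) * h + 2 * Complex.I_mul_I

noncomputable def f (a : ℤ√(-2)) : ℂ := eps a * (a.re + a.im * w)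

lemma eps_mul (a b : ℤ√(-2)) (ha : a.re % 2 = 1) (hb : b.re % 2 = 1) :
    eps (a * b) = eps a * eps b := by
  obtain ⟨x, y⟩ := a
  obtain ⟨u, v⟩ := b
  simp only at ha hb
  have key : ∀ (s t : ℤ), s % 2 = 1 → t % 2 = 1 → chi (s * t) = chi s * chi t := by
    intro s t hs ht
    have h1 : s % 4 = 1 ∨ s % 4 = 3 := by omega
    have h2 : t % 4 = 1 ∨ t % 4 = 3 := by omega
    rcases h1 with h1 | h1 <;> rcases h2 with h2 | h2 <;>
      simp [chi, Int.mul_emod, h1, h2]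
  have hxu : (x * u) % 2 = 1 := by simp [Int.mul_emod, ha, hb]
  have key2 : ∀ s t : ℤ, s % 2 = 1 → t % 2 = 0 → chi (s - 2 * t) = chi s := by
    intro s t hs ht
    have : (s - 2 * t) % 4 = s % 4 := by omega
    simp [chi, this]
  have key3 : ∀ s t : ℤ, s % 2 = 1 → t % 2 = 1 → chi (s - 2 * t) = - chi s := by
    intro s t hs ht
    have h1 : s % 4 = 1 ∨ s % 4 = 3 := by omega
    rcases h1 with h1 | h1
    · have : (s - 2 * t) % 4 = 3 := by omega
      simp [chi, this, h1]
    · have : (s - 2 * t) % 4 = 1 := by omega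
      simp [chi, this, h1]
  have e : (⟨x, y⟩ * ⟨u, v⟩ : ℤ√(-2)) = ⟨x * u - 2 * (y * v), x * v + y * u⟩ := by
    ext <;> simp <;> ring
  rw [e]
  rcases Int.emod_two_eq_zero_or_one y with hy | hy <;>
  rcases Int.emod_two_eq_zero_or_one v with hv | hv
  · have h1 : (x * v + y * u) % 2 = 0 := by simp [Int.add_emod, Int.mul_emod, ha, hb, hy, hv]
    have h2 : (y * v) % 2 = 0 := by simp [Int.mul_emod, hy, hv]
    simp [eps, h1, hy, hv, key2 _ _ hxu h2, key _ _ ha hb]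
  · have h1 : (x * v + y * u) % 2 = 1 := by simp [Int.add_emod, Int.mul_emod, ha, hb, hy, hv]
    have h2 : (y * v) % 2 = 0 := by simp [Int.mul_emod, hy, hv]
    simp [eps, h1, hy, hv, key2 _ _ hxu h2, key _ _ ha hb]; ring
  · have h1 : (x * v + y * u) % 2 = 1 := by simp [Int.add_emod, Int.mul_emod, ha, hb, hy, hv]
    have h2 : (y * v) % 2 = 0 := by simp [Int.mul_emod, hy, hv]
    simp [eps, h1, hy, hv, key2 _ _ hxu h2, key _ _ ha hb]; ring
  · have h1 : (x * v + y * u) % 2 = 0 := by simp [Int.add_emod, Int.mul_emod, ha, hb, hy, hv]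
    have h2 : (y * v) % 2 = 1 := by simp [Int.mul_emod, hy, hv]
    simp [eps, h1, hy, hv, key3 _ _ hxu h2, key _ _ ha hb]
    linear_combination (-(chi x : ℂ) * chi u) * Complex.I_mul_I

lemma f_mul (a b : ℤ√(-2)) (ha : a.re % 2 = 1) (hb : b.re % 2 = 1) :
    f (a * b) = f a * f b := by
  unfold f
  rw [eps_mul a b ha hb]
  simp
  linear_combination (-(eps a * eps b * a.im * b.im)) * w_sq

lemma eps_ne (a : ℤ√(-2)) (ha : a.re % 2 = 1) : eps a ≠ 0 := by
  have h1 : a.re % 4 = 1 ∨ a.re % 4 = 3 := by omega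
  unfold eps chi
  rcases h1 with h1 | h1 <;> simp [h1] <;> split_ifs <;> simp

lemma eps_star (a : ℤ√(-2)) : eps (star a) = eps a := by
  simp [eps]

lemma norm_eq (a : ℤ√(-2)) : a.norm = a.re ^ 2 + 2 * a.im ^ 2 := by
  rw [Zsqrtd.norm_def]; ring

noncomputable def R (N : ℕ) : Finset (ℤ√(-2)) :=
  (((Finset.Icc (-(N:ℤ)) N) ×ˢ (Finset.Icc (-(N:ℤ)) N)).image (fun p => (⟨p.1, p.2⟩ : ℤ√(-2)))).filter
    (fun a => a.norm = N)

lemma mem_R (N : ℕ) (a : ℤ√(-2)) : a ∈ R N ↔ a.norm = N := by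
  unfold R
  simp only [mem_filter, mem_image, mem_product, mem_Icc, Prod.exists, and_iff_right_iff_imp]
  intro h
  rw [norm_eq] at h
  refine ⟨a.re, a.im, ⟨⟨?_, ?_⟩, ?_, ?_⟩, rfl⟩ <;>
    nlinarith [sq_nonneg a.re, sq_nonneg a.im, Int.le_self_sq a.re, Int.le_self_sq a.im,
      Int.le_self_sq (-a.re), Int.le_self_sq (-a.im)]

lemma R_odd {N : ℕ} (hN : N % 2 = 1) {a : ℤ√(-2)} (ha : a ∈ R N) : a.re % 2 = 1 := by
  rw [mem_R, norm_eq] at ha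
  have h : (a.re ^ 2) % 2 = 1 := by omega
  rcases Int.emod_two_eq_zero_or_one a.re with h1 | h1
  · simp [pow_two, Int.mul_emod, h1] at h
  · exact h1

noncomputable def F (N : ℕ) : ℂ := ∑ a ∈ R N, f a

lemma mul_inj {a : ℤ√(-2)} (h : a.norm ≠ 0) : Function.Injective (fun b => a * b) := by
  intro b c hbc
  simp only at hbc
  have h2 : star a * a * b = star a * a * c := by rw [mul_assoc, hbc, mul_assoc]
  have h3 : star a * a = ((a.norm : ℤ) : ℤ√(-2)) := by rw [Zsqrtd.norm_eq_mul_conj, mul_comm]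
  rw [h3] at h2
  have h4 := congrArg Zsqrtd.re h2
  have h5 := congrArg Zsqrtd.im h2
  simp [h] at h4 h5
  ext <;> assumption

lemma sum_image {a : ℤ√(-2)} (h : a.norm ≠ 0) (ha : a.re % 2 = 1) {M : ℕ} (hM : M % 2 = 1) :
    ∑ b ∈ (R M).image (fun b => a * b), f b = f a * F M := by
  rw [Finset.sum_image (fun x _ y _ hxy => mul_inj h hxy), F, Finset.mul_sum]
  exact Finset.sum_congr rfl fun b hb => f_mul a b ha (R_odd hM hb)

lemma F_one : F 1 = 2 := by
  have : R 1 = {1, -1} := by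
    ext a
    rw [mem_R, norm_eq]
    simp only [mem_insert, mem_singleton]
    constructor
    · intro h
      have h1 : a.im = 0 := by
        by_contra hc
        have : 0 < a.im ^ 2 := by positivity
        push_cast at h
        nlinarith [sq_nonneg a.re]
      rw [h1] at h
      have : a.re = 1 ∨ a.re = -1 := by
        have h' : a.re ^ 2 = 1 := by simpa using h
        simpa using h'
      rcases this with h2 | h2
      · left; ext <;> simp [h1, h2]
      · right; ext <;> simp [h1, h2]
    · rintro (rfl | rfl) <;> simp
  rw [F, this, Finset.sum_pair]
  · simp [f, eps, chi]; norm_num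
  · intro h
    have := congrArg Zsqrtd.re h
    simp at this

/-- inert primes -/
lemma inert {q : ℕ} (hq : q.Prime) (h : q % 8 = 5 ∨ q % 8 = 7) {x y : ℤ}
    (hd : (q:ℤ) ∣ x ^ 2 + 2 * y ^ 2) : (q:ℤ) ∣ x ∧ (q:ℤ) ∣ y := by
  have := Fact.mk hq
  have h0 : ((x:ZMod q)) ^ 2 + 2 * (y:ZMod q) ^ 2 = 0 := by
    have := (ZMod.intCast_zmod_eq_zero_iff_dvd _ q).2 hd
    push_cast at this; exact this
  have hns : ¬ IsSquare (-2 : ZMod q) := by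
    rw [ZMod.exists_sq_eq_neg_two_iff (by rintro rfl; omega)]; omega
  have hy : (y : ZMod q) = 0 := by
    by_contra hc
    apply hns
    refine ⟨(x:ZMod q) / y, ?_⟩
    field_simp
    linear_combination -h0
  rw [hy] at h0
  have hx : (x : ZMod q) = 0 := by simpa using h0
  exact ⟨(ZMod.intCast_zmod_eq_zero_iff_dvd _ q).1 hx, (ZMod.intCast_zmod_eq_zero_iff_dvd _ q).1 hy⟩

lemma even_val {q : ℕ} (hq : q.Prime) (h : q % 8 = 5 ∨ q % 8 = 7) :
    ∀ n : ℕ, 0 < n → ∀ x y : ℤ, x ^ 2 + 2 * y ^ 2 = n → Even (padicValNat q n) := by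
  have := Fact.mk hq
  intro n
  induction n using Nat.strong_induction_on with
  | _ n ih =>
    intro hn x y hxy
    by_cases hd : q ∣ n
    · obtain ⟨⟨u, hu⟩, ⟨v, hv⟩⟩ := inert hq h (x := x) (y := y) (by rw [hxy]; exact_mod_cast hd)
      have e : (q:ℤ) ^ 2 * (u ^ 2 + 2 * v ^ 2) = n := by rw [← hxy, hu, hv]; ring
      have e2 : q ^ 2 * (u ^ 2 + 2 * v ^ 2).toNat = n := by
        zify; rw [Int.toNat_of_nonneg (by positivity)]; exact e
      set m := (u ^ 2 + 2 * v ^ 2).toNat with hm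
      have hm0 : 0 < m := by
        rcases Nat.eq_zero_or_pos m with h0 | h0
        · rw [h0] at e2; omega
        · exact h0
      have hlt : m < n := by
        have h4 : 1 < q ^ 2 := Nat.one_lt_pow two_ne_zero hq.one_lt
        rw [← e2]; nlinarith
      have := ih m hlt hm0 u v (by rw [hm, Int.toNat_of_nonneg (by positivity)])
      rw [← e2, padicValNat.mul (by have := hq.pos; positivity) hm0.ne', padicValNat.prime_pow]
      exact (by decide : Even 2).add this
    · rw [padicValNat.eq_zero_of_not_dvd hd]; exact Even.zero

lemma F_inert {q : ℕ} (hq : q.Prime) (h : q % 8 = 5 ∨ q % 8 = 7) {M : ℕ} (hM : M % 2 = 1) :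
    F (q ^ 2 * M) = f (q : ℤ√(-2)) * F M := by
  have hq0 : (q:ℤ) ≠ 0 := by exact_mod_cast hq.ne_zero
  rw [← sum_image (by simp [norm_eq, hq.ne_zero]) (by simp; omega) hM, F]
  congr 1
  ext a
  simp only [mem_image, mem_R]
  constructor
  · intro ha
    rw [norm_eq] at ha
    obtain ⟨⟨u, hu⟩, ⟨v, hv⟩⟩ := inert hq h (x := a.re) (y := a.im)
      (by rw [ha]; push_cast; exact Dvd.intro _ (by ring : (q:ℤ) * (q * M) = _))
    refine ⟨⟨u, v⟩, ?_, ?_⟩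
    · rw [norm_eq]
      rw [hu, hv] at ha
      push_cast at ha
      have : (q:ℤ)^2 * (u^2+2*v^2) = q^2 * M := by rw [← ha]; ring
      exact mul_left_cancel₀ (pow_ne_zero 2 hq0) this
    · ext <;> simp [hu, hv]
  · rintro ⟨b, hb, rfl⟩
    rw [Zsqrtd.norm_mul, hb]
    simp [norm_eq]

lemma F_split {p : ℕ} (hp : p.Prime) (hp2 : p % 2 = 1) {π : ℤ√(-2)} (hπ : π.norm = p)
    {M : ℕ} (hM : M % 2 = 1) :
    F (p * M) = eps π * (2 * π.re) * F M -
      if p ∣ M then eps π ^ 2 * p * F (M / p) else 0 := by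
  have hp0 : (p:ℤ) ≠ 0 := by exact_mod_cast hp.ne_zero
  have hpp : Prime (p:ℤ) := Nat.prime_iff_prime_int.mp hp
  have hπ0 : π.norm ≠ 0 := by rw [hπ]; exact hp0
  have hπs : (star π).norm = p := by rw [← hπ]; exact Zsqrtd.norm_conj π
  have hπs0 : (star π).norm ≠ 0 := by rw [hπs]; exact hp0
  have hre : π.re % 2 = 1 := R_odd hp2 ((mem_R _ _).2 hπ)
  have hres : (star π).re % 2 = 1 := R_odd hp2 ((mem_R _ _).2 hπs)
  have hN := hπ
  rw [norm_eq] at hN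
  have hss : π * star π = ((p:ℤ) : ℤ√(-2)) := by rw [← Zsqrtd.norm_eq_mul_conj, hπ]
  -- divisibility criterion
  have hdiv : ∀ (σ a : ℤ√(-2)), σ.norm = p → a.norm = p * M → (p:ℤ) ∣ a.im * σ.re - a.re * σ.im →
      ∃ b ∈ R M, σ * b = a := by
    intro σ a hσ ha hd
    have hσ' := hσ
    have ha' := ha
    rw [norm_eq] at hσ' ha'
    have h1 : (p:ℤ) ∣ a.re * σ.re + 2 * a.im * σ.im := by
      apply hpp.dvd_of_dvd_pow (n := 2)
      have : (a.re * σ.re + 2 * a.im * σ.im) ^ 2 = p * (p * M) - 2 * (a.im * σ.re - a.re * σ.im) ^ 2 := by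
        rw [← ha']; nth_rewrite 1 [← hσ']; ring
      rw [this]
      exact dvd_sub (Dvd.intro _ rfl) (Dvd.dvd.mul_left (dvd_pow hd two_ne_zero) _)
    obtain ⟨u, hu⟩ := h1
    obtain ⟨v, hv⟩ := hd
    have e : σ * ⟨u, v⟩ = a := by
      ext
      · apply mul_left_cancel₀ hp0
        simp only [Zsqrtd.re_mul]
        linear_combination (-σ.re) * hu + 2 * σ.im * hv + a.re * hσ'
      · apply mul_left_cancel₀ hp0
        simp only [Zsqrtd.im_mul]
        linear_combination (-σ.re) * hv - σ.im * hu + a.im * hσ'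
    refine ⟨⟨u, v⟩, ?_, e⟩
    rw [mem_R]
    apply mul_left_cancel₀ hp0
    rw [← ha, ← e, Zsqrtd.norm_mul, hσ]
  have hpM : ((p * M : ℕ) : ℤ) = p * M := by push_cast; ring
  have hU : R (p * M) = (R M).image (fun b => π * b) ∪ (R M).image (fun b => star π * b) := by
    ext a
    simp only [mem_union, mem_image]
    constructor
    · intro ha
      rw [mem_R, hpM] at ha
      have ha' := ha
      rw [norm_eq] at ha'
      have : (p:ℤ) ∣ (a.im * π.re - a.re * π.im) * (a.im * π.re + a.re * π.im) := by
        refine ⟨a.im ^ 2 - π.im ^ 2 * M, ?_⟩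
        linear_combination a.im ^ 2 * hN - π.im ^ 2 * ha'
      rcases hpp.dvd_or_dvd this with h | h
      · exact Or.inl (hdiv π a hπ ha h)
      · exact Or.inr (hdiv (star π) a hπs ha (by simpa using h))
    · rintro (⟨b, hb, rfl⟩ | ⟨b, hb, rfl⟩) <;> rw [mem_R] at * <;>
        simp [Zsqrtd.norm_mul, hb, hπ]
  have hI : (R M).image (fun b => π * b) ∩ (R M).image (fun b => star π * b) =
      if p ∣ M then (R (M / p)).image (fun b => ((p:ℤ) : ℤ√(-2)) * b) else ∅ := by
    have key : ∀ a, a ∈ (R M).image (fun b => π * b) ∩ (R M).image (fun b => star π * b) →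
        ∃ c : ℤ√(-2), a = ((p:ℤ) : ℤ√(-2)) * c ∧ p * c.norm = M := by
      intro a ha
      simp only [mem_inter, mem_image, mem_R] at ha
      obtain ⟨⟨b, hb, hba⟩, ⟨c, hc, hca⟩⟩ := ha
      have h1 : (p:ℤ) ∣ a.im * π.re - a.re * π.im := by
        refine ⟨b.im, ?_⟩
        rw [← hba]; simp
        linear_combination b.im * hN
      have h2 : (p:ℤ) ∣ a.im * π.re + a.re * π.im := by
        refine ⟨c.im, ?_⟩
        rw [← hca]; simp
        linear_combination c.im * hN
      have h2p : ¬ (p:ℤ) ∣ 2 := by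
        intro h
        have := Int.le_of_dvd (by norm_num) h
        have := hp.two_le
        omega
      have hnr : ¬ (p:ℤ) ∣ π.re := by
        intro h
        have h3 : (p:ℤ) ∣ 2 * π.im ^ 2 := by
          have : 2 * π.im ^ 2 = p - π.re ^ 2 := by rw [← hN]; ring
          rw [this]; exact dvd_sub dvd_rfl (dvd_pow h two_ne_zero)
        have h4 : (p:ℤ) ∣ π.im := by
          rcases hpp.dvd_or_dvd h3 with h | h
          · exact absurd h h2p
          · exact hpp.dvd_of_dvd_pow h
        obtain ⟨s, hs⟩ := h
        obtain ⟨t, ht⟩ := h4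
        have : (p:ℤ) * (p * (s^2 + 2 * t^2)) = p * 1 := by
          rw [hs, ht] at hN; linear_combination hN
        have := mul_left_cancel₀ hp0 this
        exact hpp.not_dvd_one (Dvd.intro _ this)
      have him : (p:ℤ) ∣ a.im := by
        have : (p:ℤ) ∣ 2 * π.re * a.im := by
          have := dvd_add h1 h2
          ring_nf at this ⊢; exact this
        rcases hpp.dvd_or_dvd this with h | h
        · rcases hpp.dvd_or_dvd h with h | h
          · exact absurd h h2p
          · exact absurd h hnr
        · exact h
      have han : a.norm = p * M := by rw [← hba, Zsqrtd.norm_mul, hπ, hb]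
      have han' := han
      rw [norm_eq] at han'
      have hare : (p:ℤ) ∣ a.re := by
        apply hpp.dvd_of_dvd_pow (n := 2)
        have : a.re ^ 2 = p * M - 2 * a.im ^ 2 := by rw [← han']; ring
        rw [this]
        exact dvd_sub (Dvd.intro _ rfl) (Dvd.dvd.mul_left (dvd_pow him two_ne_zero) _)
      obtain ⟨s, hs⟩ := hare
      obtain ⟨t, ht⟩ := him
      refine ⟨⟨s, t⟩, by ext <;> simp [hs, ht], ?_⟩
      apply mul_left_cancel₀ hp0
      rw [norm_eq, ← han', hs, ht]; ring
    split_ifs with hd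
    · obtain ⟨m, rfl⟩ := hd
      rw [Nat.mul_div_cancel_left _ hp.pos]
      ext a
      constructor
      · intro ha
        obtain ⟨c, hc, hc2⟩ := key a ha
        simp only [mem_image, mem_R]
        refine ⟨c, ?_, hc.symm⟩
        push_cast at hc2
        exact mul_left_cancel₀ hp0 hc2
      · intro ha
        simp only [mem_inter, mem_image, mem_R] at ha ⊢
        obtain ⟨c, hc, rfl⟩ := ha
        rw [← hss]
        refine ⟨⟨star π * c, ?_, by ring⟩, ⟨π * c, ?_, by ring⟩⟩
        · rw [Zsqrtd.norm_mul, hπs, hc]; push_cast; ring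
        · rw [Zsqrtd.norm_mul, hπ, hc]; push_cast; ring
    · rw [Finset.eq_empty_iff_forall_notMem]
      intro a ha
      obtain ⟨c, hc, hc2⟩ := key a ha
      exact hd (by exact_mod_cast Dvd.intro _ hc2)
  have hsum := Finset.sum_union_inter (s₁ := (R M).image (fun b => π * b))
    (s₂ := (R M).image (fun b => star π * b)) (f := f)
  rw [← hU, hI, sum_image hπ0 hre hM, sum_image hπs0 hres hM] at hsum
  have e1 : f π * F M + f (star π) * F M = eps π * (2 * π.re) * F M := by
    unfold f; rw [eps_star]; simp; ring
  have e2 : f ((p:ℤ) : ℤ√(-2)) = eps π ^ 2 * p := by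
    rw [← hss, f_mul _ _ hre hres]
    unfold f
    rw [eps_star]
    have : (p:ℂ) = π.re ^ 2 + 2 * π.im ^ 2 := by exact_mod_cast hN.symm
    rw [this]; simp
    linear_combination (-eps π ^ 2 * π.im ^ 2) * w_sq
  rw [e1] at hsum
  rw [← hsum]
  change F (p * M) = F (p * M) + _ - _
  split_ifs with hd
  · rw [sum_image, e2]
    · ring
    · simp [norm_eq, hp.ne_zero]
    · simp; omega
    · obtain ⟨m, rfl⟩ := hd
      rw [Nat.mul_div_cancel_left _ hp.pos]
      rcases Nat.mod_two_eq_zero_or_one m with h | h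
      · simp [Nat.mul_mod, h] at hM
      · exact h
  · simp

/-- Thue argument -/
lemma exists_pi {p : ℕ} (hp : p.Prime) (h : p % 8 = 1 ∨ p % 8 = 3) :
    ∃ π : ℤ√(-2), π.norm = p := by
  have := Fact.mk hp
  obtain ⟨s, hs⟩ := (ZMod.exists_sq_eq_neg_two_iff (p := p) (by rintro rfl; omega)).2 h
  set r := Nat.sqrt p with hr
  have hr1 : p < (r + 1) * (r + 1) := Nat.lt_succ_sqrt p
  have hr2 : r * r < p := by
    rcases lt_or_eq_of_le (Nat.sqrt_le p) with h | h
    · exact h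
    · exact absurd ⟨Nat.sqrt p, h.symm⟩ (Irreducible.not_isSquare hp)
  obtain ⟨a, ha, b, hb, hab, he⟩ := Finset.exists_ne_map_eq_of_card_lt_of_maps_to
    (s := Finset.range (r+1) ×ˢ Finset.range (r+1)) (t := (Finset.univ : Finset (ZMod p)))
    (by rw [Finset.card_product, Finset.card_range, Finset.card_univ, ZMod.card]; exact hr1)
    (f := fun a => (a.1 : ZMod p) - s * a.2) (fun _ _ => by simp)
  obtain ⟨a1, a2⟩ := a
  obtain ⟨b1, b2⟩ := b
  simp only [mem_product, mem_range] at ha hb he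
  set x : ℤ := a1 - b1 with hx
  set y : ℤ := a2 - b2 with hy
  have hxy : x ≠ 0 ∨ y ≠ 0 := by
    by_contra hc
    push Not at hc
    apply hab
    ext <;> simp <;> omega
  have hdvd : (p:ℤ) ∣ x ^ 2 + 2 * y ^ 2 := by
    rw [← ZMod.intCast_zmod_eq_zero_iff_dvd]
    simp only [hx, hy]; push_cast
    have : (a1 : ZMod p) - b1 = s * (a2 - b2) := by linear_combination he
    rw [this]
    linear_combination (-((a2:ZMod p) - b2) ^ 2) * hs
  have hxb : x ^ 2 ≤ r * r := by
    have h1 : x ≤ r := by omega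
    have h2 : -r ≤ x := by omega
    nlinarith
  have hyb : y ^ 2 ≤ r * r := by
    have h1 : y ≤ r := by omega
    have h2 : -r ≤ y := by omega
    nlinarith
  have hr3 : (r:ℤ) * r < p := by exact_mod_cast hr2
  have hpos : 0 < x ^ 2 + 2 * y ^ 2 := by
    rcases hxy with h | h <;> positivity
  obtain ⟨k, hk⟩ := hdvd
  have hp0 : (0:ℤ) < p := by exact_mod_cast hp.pos
  have hk1 : 0 < k := by
    by_contra hc
    nlinarith
  have hk3 : k < 3 := by
    by_contra hc
    nlinarith
  have : k = 1 ∨ k = 2 := by omega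
  rcases this with rfl | rfl
  · exact ⟨⟨x, y⟩, by rw [norm_eq]; simpa using hk⟩
  · have hx2 : (2:ℤ) ∣ x := by
      apply Int.prime_two.dvd_of_dvd_pow (n := 2)
      omega
    obtain ⟨z, hz⟩ := hx2
    refine ⟨⟨y, z⟩, ?_⟩
    rw [norm_eq]
    simp only
    rw [hz] at hk
    linarith

def c (t p : ℤ) : ℕ → ℤ
  | 0 => 1
  | 1 => t
  | (k+2) => t * c t p (k+1) - p * c t p k

lemma c_mod (t p : ℤ) : ∀ k, p ∣ c t p k - t ^ k
  | 0 => by simp [c]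
  | 1 => by simp [c]
  | (k+2) => by
    obtain ⟨d, hd⟩ := c_mod t p (k+1)
    refine ⟨t * d - c t p k, ?_⟩
    simp only [c]
    linear_combination t * hd

lemma odd_mul {a b : ℕ} (h : (a * b) % 2 = 1) : a % 2 = 1 ∧ b % 2 = 1 := by
  have := Nat.odd_iff.2 h
  rw [Nat.odd_mul] at this
  exact ⟨Nat.odd_iff.1 this.1, Nat.odd_iff.1 this.2⟩

lemma odd_pow_mul {p m : ℕ} (hp : p % 2 = 1) (hm : m % 2 = 1) (k : ℕ) : (p ^ k * m) % 2 = 1 :=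
  Nat.odd_iff.1 (((Nat.odd_iff.2 hp).pow).mul (Nat.odd_iff.2 hm))

lemma F_pow {p : ℕ} (hp : p.Prime) (hp2 : p % 2 = 1) {π : ℤ√(-2)} (hπ : π.norm = p)
    {m : ℕ} (hm : m % 2 = 1) (hpm : ¬ p ∣ m) :
    ∀ k, F (p ^ k * m) = eps π ^ k * c (2 * π.re) p k * F m
  | 0 => by simp [c]
  | 1 => by
    rw [pow_one, F_split hp hp2 hπ hm, if_neg hpm]; simp [c]
  | (k+2) => by
    have e : p ^ (k+2) * m = p * (p ^ (k+1) * m) := by ring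
    have e2 : p ^ (k+1) * m = p * (p ^ k * m) := by ring
    rw [e, F_split hp hp2 hπ (odd_pow_mul hp2 hm _), if_pos (by rw [e2]; exact Dvd.intro _ rfl),
      F_pow hp hp2 hπ hm hpm (k+1), e2, Nat.mul_div_cancel_left _ hp.pos,
      F_pow hp hp2 hπ hm hpm k]
    simp only [c]; push_cast; ring

lemma c_ne {p : ℕ} (hp : p.Prime) (hp2 : p % 2 = 1) {π : ℤ√(-2)} (hπ : π.norm = p) (k : ℕ) :
    c (2 * π.re) p k ≠ 0 := by
  have hpp : Prime (p:ℤ) := Nat.prime_iff_prime_int.mp hp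
  have hp0 : (0:ℤ) < p := by exact_mod_cast hp.pos
  have hN := hπ
  rw [norm_eq] at hN
  have hre : π.re % 2 = 1 := R_odd hp2 ((mem_R _ _).2 hπ)
  intro h
  have h1 := c_mod (2 * π.re) p k
  rw [h, zero_sub, dvd_neg] at h1
  have h2 := hpp.dvd_of_dvd_pow h1
  rcases hpp.dvd_or_dvd h2 with h3 | h3
  · have := Int.le_of_dvd (by norm_num) h3
    have := hp.two_le
    omega
  · have hr0 : π.re ≠ 0 := by rintro h; rw [h] at hre; simp at hre
    have h4 : (p:ℤ)^2 ∣ π.re ^ 2 := pow_dvd_pow_of_dvd h3 2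
    have h5 := Int.le_of_dvd (by positivity) h4
    have : (2:ℤ) ≤ p := by exact_mod_cast hp.two_le
    nlinarith [sq_nonneg π.im]

lemma F_inert_pow {q : ℕ} (hq : q.Prime) (h : q % 8 = 5 ∨ q % 8 = 7) {m : ℕ} (hm : m % 2 = 1) :
    ∀ j, F (q ^ (2 * j) * m) = f (q : ℤ√(-2)) ^ j * F m
  | 0 => by simp
  | (j+1) => by
    have e : q ^ (2 * (j+1)) * m = q ^ 2 * (q ^ (2 * j) * m) := by ring
    rw [e, F_inert hq h (odd_pow_mul (by omega) hm _), F_inert_pow hq h hm j]; ring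

lemma F_ne : ∀ n : ℕ, n % 2 = 1 →
    (∀ q : ℕ, q.Prime → (q % 8 = 5 ∨ q % 8 = 7) → Even (padicValNat q n)) → F n ≠ 0 := by
  intro n
  induction n using Nat.strong_induction_on with
  | _ n ih =>
    intro hn hev
    by_cases h1 : n = 1
    · rw [h1, F_one]; norm_num
    have hn0 : n ≠ 0 := by rintro rfl; simp at hn
    have hp := Nat.minFac_prime h1
    have hpd := Nat.minFac_dvd n
    set p := n.minFac with hpdef
    obtain ⟨k, m, hpm, hnm⟩ := Nat.exists_eq_pow_mul_and_not_dvd hn0 p hp.ne_one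
    have hm0 : m ≠ 0 := by rintro rfl; simp at hpm
    have hk : k ≠ 0 := by 
      intro h0
      apply hpm
      rw [h0, pow_zero, one_mul] at hnm
      rw [← hnm]; exact hpd
    have hm2 : m % 2 = 1 := by rw [hnm] at hn; exact (odd_mul hn).2
    have hp2 : p % 2 = 1 := by
      obtain ⟨d, hd⟩ := hpd
      rw [hd] at hn; exact (odd_mul hn).1
    have hlt : m < n := by
      have : 1 < p ^ k := Nat.one_lt_pow hk hp.one_lt
      rw [hnm]; have := Nat.pos_of_ne_zero hm0; nlinarith
    have := Fact.mk hp
    have hpv : padicValNat p n = k := by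
      rw [hnm, padicValNat.mul (pow_ne_zero _ hp.ne_zero) hm0, padicValNat.prime_pow,
        padicValNat.eq_zero_of_not_dvd hpm, add_zero]
    have hFm : F m ≠ 0 := by
      apply ih m hlt hm2
      intro q hq hq8
      have := Fact.mk hq
      by_cases hqp : q = p
      · rw [hqp, padicValNat.eq_zero_of_not_dvd hpm]; exact Even.zero
      · have := hev q hq hq8
        rw [hnm, padicValNat.mul (pow_ne_zero _ hp.ne_zero) hm0,
          padicValNat.eq_zero_of_not_dvd (n := p ^ k), zero_add] at this
        · exact this
        · intro hd
          exact hqp ((Nat.prime_dvd_prime_iff_eq hq hp).1 (hq.dvd_of_dvd_pow hd))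
    by_cases h8 : p % 8 = 5 ∨ p % 8 = 7
    · have := hev p hp h8
      rw [hpv] at this
      obtain ⟨j, hj⟩ := this
      rw [hnm, show k = 2 * j by omega, F_inert_pow hp h8 hm2]
      refine mul_ne_zero (pow_ne_zero _ ?_) hFm
      unfold f
      refine mul_ne_zero (eps_ne _ (by simp; omega)) ?_
      simp [hp.ne_zero]
    · obtain ⟨π, hπ⟩ := exists_pi hp (by omega)
      rw [hnm, F_pow hp hp2 hπ hm2 hpm]
      refine mul_ne_zero (mul_ne_zero (pow_ne_zero _ (eps_ne _ ?_)) ?_) hFm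
      · exact R_odd hp2 ((mem_R _ _).2 hπ)
      · exact_mod_cast c_ne hp hp2 hπ k

lemma chi_neg (x : ℤ) : chi (-x) = - chi x := by
  unfold chi
  split_ifs <;> omega

lemma chi_abs (x : ℤ) : χm4 x.natAbs * x.natAbs = chi x * x := by
  have h : ∀ m : ℕ, χm4 m = chi m := by
    intro m; unfold χm4 chi; split_ifs <;> omega
  rw [h]
  rcases Int.natAbs_eq x with e | e
  · rw [← e]
  · have : (x.natAbs : ℤ) = -x := by omega
    rw [this, chi_neg]; ring

lemma sq_odd {n : ℕ} (h8 : n % 8 = 3) {x y : ℤ} (h : x ^ 2 + 2 * y ^ 2 = n) :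
    x % 2 = 1 ∧ y % 2 = 1 := by
  have hx : x % 2 = 1 := by
    rcases Int.emod_two_eq_zero_or_one x with h1 | h1
    · have : (x ^ 2) % 2 = 0 := by simp [pow_two, Int.mul_emod, h1]
      omega
    · exact h1
  refine ⟨hx, ?_⟩
  rcases Int.emod_two_eq_zero_or_one y with h1 | h1
  · have h2 : (x ^ 2) % 8 = 1 := by
      have h3 : x % 8 = 1 ∨ x % 8 = 3 ∨ x % 8 = 5 ∨ x % 8 = 7 := by omega
      rcases h3 with h3 | h3 | h3 | h3 <;> simp [pow_two, Int.mul_emod, h3]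
    obtain ⟨z, hz⟩ := Int.dvd_of_emod_eq_zero h1
    have : y ^ 2 = 4 * z ^ 2 := by rw [hz]; ring
    omega
  · exact h1

lemma F_eq {n : ℕ} (h8 : n % 8 = 3) :
    F n = Complex.I * (4 * ∑ p ∈ (Finset.Icc 1 n ×ˢ Finset.Icc 1 n).filter
      (fun p => p.1 ^ 2 + 2 * p.2 ^ 2 = n), χm4 p.1 * p.1 : ℤ) := by
  have hA : F n = Complex.I * (∑ a ∈ R n, chi a.re * a.re : ℤ) +
      Complex.I * w * (∑ a ∈ R n, chi a.re * a.im : ℤ) := by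
    unfold F
    push_cast
    rw [Finset.mul_sum, Finset.mul_sum, ← Finset.sum_add_distrib]
    refine Finset.sum_congr rfl fun a ha => ?_
    rw [mem_R, norm_eq] at ha
    have := (sq_odd h8 ha).2
    unfold f eps
    rw [if_neg (by omega)]; ring
  have hB : (∑ a ∈ R n, chi a.re * a.im : ℤ) = 0 := by
    have : (∑ a ∈ R n, chi a.re * a.im : ℤ) = ∑ a ∈ R n, -(chi a.re * a.im) := by
      refine Finset.sum_bij' (fun a _ => star a) (fun a _ => star a) ?_ ?_ ?_ ?_ ?_
      · intro a ha; rw [mem_R] at *; rw [← ha]; exact Zsqrtd.norm_conj a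
      · intro a ha; rw [mem_R] at *; rw [← ha]; exact Zsqrtd.norm_conj a
      · simp
      · simp
      · simp
    rw [Finset.sum_neg_distrib] at this
    omega
  rw [hA, hB]
  simp only [Int.cast_zero, mul_zero, add_zero]
  congr 2
  rw [← Finset.sum_fiberwise_of_maps_to (s := R n)
    (t := (Finset.Icc 1 n ×ˢ Finset.Icc 1 n).filter (fun p => p.1 ^ 2 + 2 * p.2 ^ 2 = n))
    (g := fun a => (a.re.natAbs, a.im.natAbs)), Finset.mul_sum]
  · refine Finset.sum_congr rfl ?_
    rintro ⟨u, v⟩ huv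
    simp only [mem_filter, mem_product, mem_Icc] at huv
    obtain ⟨⟨⟨hu, -⟩, hv, -⟩, he⟩ := huv
    have hset : (R n).filter (fun a => (a.re.natAbs, a.im.natAbs) = (u, v)) =
        {⟨u, v⟩, ⟨u, -v⟩, ⟨-u, v⟩, ⟨-u, -v⟩} := by
      ext a
      have he' : (u:ℤ) ^ 2 + 2 * (v:ℤ) ^ 2 = n := by exact_mod_cast he
      simp only [mem_filter, mem_R, norm_eq, mem_insert, mem_singleton, Prod.mk.injEq, Zsqrtd.ext_iff]
      constructor
      · rintro ⟨-, h1, h2⟩; omega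
      · rintro (⟨h1, h2⟩ | ⟨h1, h2⟩ | ⟨h1, h2⟩ | ⟨h1, h2⟩) <;> rw [h1, h2] <;> simp [he']
    have hs : ∀ a ∈ (R n).filter (fun a => (a.re.natAbs, a.im.natAbs) = (u, v)),
        chi a.re * a.re = χm4 u * u := by
      intro a ha
      simp only [mem_filter, Prod.mk.injEq] at ha
      rw [← chi_abs, ha.2.1]
    rw [Finset.sum_congr rfl hs, hset, Finset.sum_const]
    have : Finset.card ({⟨u, v⟩, ⟨u, -v⟩, ⟨-u, v⟩, ⟨-u, -v⟩} : Finset (ℤ√(-2))) = 4 := by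
      rw [Finset.card_insert_of_notMem, Finset.card_insert_of_notMem, Finset.card_insert_of_notMem,
        Finset.card_singleton] <;> simp [Zsqrtd.ext_iff] <;> omega
    rw [this]; simp
  · intro a ha
    rw [mem_R, norm_eq] at ha
    have ho := sq_odd h8 ha
    have h1 : 1 ≤ a.re.natAbs := by omega
    have h2 : 1 ≤ a.im.natAbs := by omega
    have he : a.re.natAbs ^ 2 + 2 * a.im.natAbs ^ 2 = n := by
      zify; simpa using ha
    simp only [mem_filter, mem_product, mem_Icc]
    refine ⟨⟨⟨h1, ?_⟩, h2, ?_⟩, he⟩ <;> nlinarith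

end G6

theorem g6_coeff_vanishing (n : ℕ) (hn : 0 < n) (h8 : n % 8 = 3) :
    ∑ p ∈ (Finset.Icc 1 n ×ˢ Finset.Icc 1 n).filter (fun p => p.1 ^ 2 + 2 * p.2 ^ 2 = n), χm4 p.1 * p.1 = 0 ↔
    ∃ p : ℕ, p.Prime ∧ (p % 8 = 5 ∨ p % 8 = 7) ∧ Odd (padicValNat p n) := by
  constructor
  · intro h
    by_contra hc
    refine G6.F_ne n (by omega) (fun q hq hq8 => ?_) ?_
    · by_contra hne
      exact hc ⟨q, hq, hq8, Nat.not_even_iff_odd.1 hne⟩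
    · rw [G6.F_eq h8, h]; simp
  · rintro ⟨p, hp, hp8, hodd⟩
    rw [Finset.filter_eq_empty_iff.2, Finset.sum_empty]
    rintro ⟨x, y⟩ - he
    have := G6.even_val hp hp8 n hn x y (by exact_mod_cast he)
    exact (Nat.not_even_iff_odd.2 hodd) this
end

section
/- For every positive integer n with n ≡ 3 (mod 8), the sum Σ over pairs of positive integers (m₁,m₂) with m₁²+2m₂² = n of χ_{−4}(m₁)·χ_{−4}(m₂)·m₁·m₂ equals 0 if and only if there exists a prime p with p ≡ 5 (mod 8) or p ≡ 7 (mod 8) such that ord_p(n) is odd. -/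
open Finset

namespace G7

/-- The ring `ℤ[√-2]`. -/
abbrev R := ℤ√(-2)

/-- the elements of norm `n` -/
noncomputable def A (n : ℕ) : Finset R :=
  ((Finset.Icc (-(n : ℤ)) n ×ˢ Finset.Icc (-(n : ℤ)) n).image
    (fun p => (⟨p.1, p.2⟩ : R))).filter (fun x => x.norm = n)

lemma norm_eq (x : R) : x.norm = x.re ^ 2 + 2 * x.im ^ 2 := by
  rw [Zsqrtd.norm_def]; ring

lemma mem_A {n : ℕ} {x : R} : x ∈ A n ↔ x.norm = n := by
  unfold A
  rw [Finset.mem_filter, Finset.mem_image]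
  refine ⟨fun h => h.2, fun h => ⟨⟨(x.re, x.im), ?_, rfl⟩, h⟩⟩
  rw [norm_eq] at h
  simp only [Finset.mem_product, Finset.mem_Icc]
  refine ⟨⟨?_, ?_⟩, ?_, ?_⟩ <;> nlinarith [sq_nonneg x.re, sq_nonneg x.im,
    Int.le_self_sq x.re, Int.le_self_sq x.im, Int.le_self_sq (-x.re), Int.le_self_sq (-x.im)]

/-- a square root of `-2` -/
noncomputable def w : ℂ := Complex.I * (Real.sqrt 2 : ℝ)

lemma w_sq : w * w = -2 := by
  unfold w
  have : ((Real.sqrt 2 : ℝ) : ℂ) * ((Real.sqrt 2 : ℝ) : ℂ) = 2 := by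
    rw [← Complex.ofReal_mul, Real.mul_self_sqrt (by norm_num)]; norm_num
  linear_combination (Complex.I * Complex.I) * this + 2 * Complex.I_mul_I

/-- the embedding into `ℂ` -/
noncomputable def φ : R →+* ℂ := Zsqrtd.lift ⟨w, by rw [w_sq]; norm_num⟩

lemma φ_apply (x : R) : φ x = x.re + x.im * w := by
  simp [φ]

lemma φ_inj : Function.Injective φ := by
  apply Zsqrtd.lift_injective
  intro n h
  nlinarith [mul_self_nonneg n]

/-- the Hecke character -/
noncomputable def ψ (x : R) : ℂ := Complex.I ^ (x.re * x.im) * φ x ^ 2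

lemma I_zpow_four (k : ℤ) : Complex.I ^ (4 * k) = 1 := by
  rw [zpow_mul]
  have : Complex.I ^ (4 : ℤ) = 1 := by
    rw [show (4 : ℤ) = ((4 : ℕ) : ℤ) by norm_num, zpow_natCast, Complex.I_pow_four]
  rw [this, one_zpow]

lemma ψ_mul (x y : R) (hx : Odd x.re) (hy : Odd y.re) : ψ (x * y) = ψ x * ψ y := by
  unfold ψ
  have key : ∃ k, (x * y).re * (x * y).im = x.re * x.im + y.re * y.im + 4 * k := by
    obtain ⟨a, ha⟩ := hx
    obtain ⟨c, hc⟩ := hy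
    have h : (4 : ℤ) ∣ (x * y).re * (x * y).im - (x.re * x.im + y.re * y.im) := by
      rw [Zsqrtd.re_mul, Zsqrtd.im_mul, ha, hc]
      generalize x.im = b
      generalize y.im = d
      obtain ⟨s, hs⟩ := Int.even_mul_succ_self b
      obtain ⟨t, ht⟩ := Int.even_mul_succ_self d
      have e : (2 * a + 1) * (2 * c + 1) * ((2 * a + 1) * d + b * (2 * c + 1)) + -2 * b * d *
         ((2 * a + 1) * d + b * (2 * c + 1)) - ((2 * a + 1) * b + (2 * c + 1) * d) =
         4 * ((a*a+a) * (2*c+1) * d + (c*c+c) * (2 * a+1) * b) - 4 * (a*b*d*d + c*b*b*d) -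
          2 * b * d * (d + b)  := by ring
      have e2 : 2 * b * d * (d + b) = 4 * (b * t + s * d - b * d) := by
        linear_combination 2 * b * ht + 2 * d * hs
      refine ⟨((a*a+a) * (2*c+1) * d + (c*c+c) * (2 * a+1) * b) - (a*b*d*d + c*b*b*d) - (b * t + s * d - b * d), ?_⟩
      linear_combination e - e2
    obtain ⟨k, hk⟩ := h
    exact ⟨k, by linarith⟩
  obtain ⟨k, hk⟩ := key
  rw [hk, map_mul, zpow_add₀ Complex.I_ne_zero, zpow_add₀ Complex.I_ne_zero, I_zpow_four]
  ring

/-- the coefficient -/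
noncomputable def F (n : ℕ) : ℂ := ∑ x ∈ A n, ψ x

lemma odd_re {n : ℕ} (hn : Odd n) {x : R} (hx : x.norm = n) : Odd x.re := by
  rw [norm_eq] at hx
  have h : Odd (n : ℤ) := by exact_mod_cast hn
  rw [← hx] at h
  by_contra h2
  rw [Int.not_odd_iff_even] at h2
  obtain ⟨k, hk⟩ := h2
  obtain ⟨l, hl⟩ := h
  rw [hk] at hl
  have : 2 * (2 * k ^2 + x.im ^ 2 - l) = 1 := by linarith
  omega

lemma sum_image {m : ℕ} (hm : Odd m) (g : R) (hg : Odd g.re) :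
    ∑ x ∈ (A m).image (fun x => g * x), ψ x = ψ g * F m := by
  rw [Finset.sum_image, F, Finset.mul_sum]
  · refine Finset.sum_congr rfl fun x hx => ψ_mul _ _ hg (odd_re hm (mem_A.1 hx))
  · intro x _ y _ h
    have : g ≠ 0 := by rintro rfl; simp at hg
    have h' := congrArg φ h
    simp only [map_mul] at h'
    have h0 : φ g ≠ 0 := by
      rw [Ne, map_eq_zero_iff φ φ_inj]; exact this
    exact φ_inj (mul_left_cancel₀ h0 h')

lemma F_one : F 1 = 2 := by
  have : A 1 = {1, -1} := by
    ext x
    rw [mem_A, norm_eq]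
    simp only [Finset.mem_insert, Finset.mem_singleton, Zsqrtd.ext_iff]
    simp
    constructor
    · intro h
      have h1 : x.im = 0 := by nlinarith [Int.one_le_abs (z := x.im), sq_abs x.im, sq_nonneg x.re, sq_nonneg x.im, pow_eq_zero_iff (two_ne_zero) (a := x.im)]
      rw [h1] at h ⊢
      have : x.re ^ 2 = 1 := by linarith
      rcases (sq_eq_sq_iff_eq_or_eq_neg.1 (this.trans (one_pow 2).symm)) with h | h <;> simp [h]
    · rintro (⟨h, h'⟩ | ⟨h, h'⟩) <;> simp [h, h']
  rw [F, this, Finset.sum_pair]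
  · simp [ψ]; norm_num
  · intro h
    have := congrArg Zsqrtd.re h
    norm_num at this

lemma exists_rep (p : ℕ) (hp : p.Prime) (h : p % 8 = 1 ∨ p % 8 = 3) :
    ∃ a b : ℤ, a ^ 2 + 2 * b ^ 2 = p := by
  have : Fact p.Prime := ⟨hp⟩
  have hp2 : p ≠ 2 := by rintro rfl; omega
  obtain ⟨r, hr⟩ := (ZMod.exists_sq_eq_neg_two_iff hp2).2 h
  set s := Nat.sqrt p with hs
  have hs1 : p < (s + 1) * (s + 1) := Nat.lt_succ_sqrt p
  have hs2 : s * s ≤ p := Nat.sqrt_le p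
  have hs3 : s * s ≠ p := by
    intro h
    rw [← h] at hp
    exact (Nat.not_prime_mul (a := s) (b := s) (by rintro h1; rw [h1] at hp; norm_num at hp)
      (by rintro h1; rw [h1] at hp; norm_num at hp)) hp
  have hs4 : s * s < p := lt_of_le_of_ne hs2 hs3
  obtain ⟨u, hu, v, hv, huv, he⟩ := Finset.exists_ne_map_eq_of_card_lt_of_maps_to
    (s := Finset.range (s+1) ×ˢ Finset.range (s+1)) (t := (Finset.univ : Finset (ZMod p)))
    (f := fun q => (q.1 : ZMod p) - r * q.2)
    (by rw [Finset.card_product, Finset.card_range, Finset.card_univ, ZMod.card]; exact hs1)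
    (fun _ _ => Finset.mem_coe.2 (Finset.mem_univ _))
  simp only [Finset.mem_product, Finset.mem_range] at hu hv
  set x : ℤ := (u.1 : ℤ) - v.1 with hx
  set y : ℤ := (u.2 : ℤ) - v.2 with hy
  have hxy : (x : ZMod p) = r * y := by
    rw [hx, hy]; push_cast
    linear_combination he
  have hd : (p : ℤ) ∣ x ^ 2 + 2 * y ^ 2 := by
    rw [← ZMod.intCast_zmod_eq_zero_iff_dvd]
    push_cast
    rw [hxy]
    linear_combination (-(y : ZMod p) ^ 2) * hr
  have hxs : x ^ 2 ≤ (s : ℤ) * s := by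
    rw [← pow_two]; apply sq_le_sq'  <;> omega
  have hys : y ^ 2 ≤ (s : ℤ) * s := by
    rw [← pow_two]; apply sq_le_sq'  <;> omega
  have hs5 : (s : ℤ) * s < p := by exact_mod_cast hs4
  have hpos : 0 < x ^ 2 + 2 * y ^ 2 := by
    by_contra hc
    have h1 : x ^ 2 = 0 := by nlinarith [sq_nonneg x, sq_nonneg y]
    have h2 : y ^ 2 = 0 := by nlinarith [sq_nonneg x, sq_nonneg y]
    have h3 := pow_eq_zero_iff (two_ne_zero) |>.1 h1
    have h4 := pow_eq_zero_iff (two_ne_zero) |>.1 h2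
    apply huv
    ext <;> omega
  obtain ⟨k, hk⟩ := hd
  have hk0 : 0 < k := by
    have hp0 : (0 : ℤ) < p := by exact_mod_cast hp.pos
    rw [hk] at hpos
    exact pos_of_mul_pos_right hpos hp0.le
  have hk3 : k < 3 := by nlinarith
  interval_cases k
  · exact ⟨x, y, by linarith⟩
  · have : Even (x ^ 2) := ⟨p - y ^ 2, by linarith⟩
    rw [Int.even_pow' two_ne_zero] at this
    obtain ⟨z, hz⟩ := this
    refine ⟨y, z, ?_⟩
    rw [hz] at hk
    nlinarith

lemma dvd_of {p : ℕ} (hp : p.Prime) {a b : ℤ} (hab : a ^ 2 + 2 * b ^ 2 = p) {x : R}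
    (h1 : (p : ℤ) ∣ a * x.im - b * x.re) (h2 : (p : ℤ) ∣ x.norm) :
    ∃ y : R, x = (⟨a, b⟩ : R) * y := by
  have hpp : Prime (p : ℤ) := Nat.prime_iff_prime_int.1 hp
  have h3 : (p : ℤ) ∣ a * x.re + 2 * b * x.im := by
    apply hpp.dvd_of_dvd_pow (n := 2)
    have e : (a * x.re + 2 * b * x.im) ^ 2 =
        p * x.norm - 2 * (a * x.im - b * x.re) * (a * x.im - b * x.re) := by
      rw [norm_eq, ← hab]; ring
    rw [e]
    exact dvd_sub (dvd_mul_right _ _) (dvd_mul_of_dvd_right h1 _)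
  obtain ⟨u, hu⟩ := h3
  obtain ⟨v, hv⟩ := h1
  have hp0 : (p : ℤ) ≠ 0 := hpp.ne_zero
  refine ⟨⟨u, v⟩, ?_⟩
  rw [Zsqrtd.ext_iff]
  simp only [Zsqrtd.re_mul, Zsqrtd.im_mul]
  constructor
  · apply mul_left_cancel₀ hp0
    linear_combination a * hu - 2 * b * hv - x.re * hab
  · apply mul_left_cancel₀ hp0
    linear_combination b * hu + a * hv - x.im * hab

lemma dvd_conv {p : ℕ} {a b : ℤ} (hab : a ^ 2 + 2 * b ^ 2 = p) (y : R) :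
    (p : ℤ) ∣ a * ((⟨a, b⟩ : R) * y).im - b * ((⟨a, b⟩ : R) * y).re := by
  simp only [Zsqrtd.re_mul, Zsqrtd.im_mul]
  exact ⟨y.im, by rw [← hab]; ring⟩

lemma norm_mk {p : ℕ} {a b : ℤ} (hab : a ^ 2 + 2 * b ^ 2 = p) :
    (⟨a, b⟩ : R).norm = p := by
  rw [norm_eq]; exact hab

lemma A_split {p : ℕ} (hp : p.Prime) {a b : ℤ} (hab : a ^ 2 + 2 * b ^ 2 = p)
    (m : ℕ) : A (p * m) = (A m).image (fun y => (⟨a, b⟩ : R) * y) ∪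
      (A m).image (fun y => (⟨a, -b⟩ : R) * y) := by
  have hpp : Prime (p : ℤ) := Nat.prime_iff_prime_int.1 hp
  have hab' : a ^ 2 + 2 * (-b) ^ 2 = p := by rw [neg_sq]; exact hab
  ext x
  simp only [Finset.mem_union, Finset.mem_image, mem_A]
  constructor
  · intro hx
    push_cast at hx
    have hd : (p : ℤ) ∣ x.norm := ⟨m, hx⟩
    have h : (p : ℤ) ∣ (a * x.im - b * x.re) * (a * x.im - (-b) * x.re) := by
      have e : (a * x.im - b * x.re) * (a * x.im - (-b) * x.re) =
        p * x.im ^ 2 - b ^ 2 * x.norm := by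
        rw [norm_eq, ← hab]; ring
      rw [e]
      exact dvd_sub (dvd_mul_right _ _) (dvd_mul_of_dvd_right hd _)
    rcases hpp.dvd_or_dvd h with h | h
    · obtain ⟨y, rfl⟩ := dvd_of hp hab h hd
      refine Or.inl ⟨y, ?_, rfl⟩
      rw [Zsqrtd.norm_mul, norm_mk hab] at hx
      exact mul_left_cancel₀ hpp.ne_zero hx
    · obtain ⟨y, rfl⟩ := dvd_of hp hab' h hd
      refine Or.inr ⟨y, ?_, rfl⟩
      rw [Zsqrtd.norm_mul, norm_mk hab'] at hx
      exact mul_left_cancel₀ hpp.ne_zero hx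
  · rintro (⟨y, hy, rfl⟩ | ⟨y, hy, rfl⟩)
    · rw [Zsqrtd.norm_mul, norm_mk hab, hy]; push_cast; rfl
    · rw [Zsqrtd.norm_mul, norm_mk hab', hy]; push_cast; rfl

lemma not_dvd_b {p : ℕ} (hp : p.Prime) {a b : ℤ}
    (hab : a ^ 2 + 2 * b ^ 2 = p) : ¬ (p : ℤ) ∣ b := by
  have hpp : Prime (p : ℤ) := Nat.prime_iff_prime_int.1 hp
  rintro ⟨c, hc⟩
  have hp1 : (2 : ℤ) ≤ p := by exact_mod_cast hp.two_le
  have hd : (p : ℤ) ∣ a := by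
    apply hpp.dvd_of_dvd_pow (n := 2)
    exact ⟨1 - 2 * b * c, by linear_combination hab - 2 * b * hc⟩
  obtain ⟨d, hd⟩ := hd
  rw [hc, hd] at hab
  have h : (p : ℤ) * (p * (d ^ 2 + 2 * c ^ 2)) = p * 1 := by linarith
  have h2 := mul_left_cancel₀ hpp.ne_zero h
  exact hpp.not_dvd_one ⟨_, h2.symm⟩

lemma not_dvd_a {p : ℕ} (hp : p.Prime) (hp2 : p ≠ 2) {a b : ℤ}
    (hab : a ^ 2 + 2 * b ^ 2 = p) : ¬ (p : ℤ) ∣ a := by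
  have hpp : Prime (p : ℤ) := Nat.prime_iff_prime_int.1 hp
  intro h
  have hb : (p : ℤ) ∣ 2 * b ^ 2 := by
    rw [eq_sub_of_add_eq' hab]
    exact dvd_sub dvd_rfl (dvd_pow h two_ne_zero)
  rcases hpp.dvd_or_dvd hb with hb | hb
  · have : p ∣ 2 := by exact_mod_cast hb
    exact hp2 ((Nat.prime_dvd_prime_iff_eq hp Nat.prime_two).1 this)
  · exact not_dvd_b hp hab (hpp.dvd_of_dvd_pow hb)

lemma dvd_both {p : ℕ} (hp : p.Prime) (hp2 : p ≠ 2) {a b : ℤ}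
    (hab : a ^ 2 + 2 * b ^ 2 = p) {x y z : R} (hy : (⟨a, b⟩ : R) * y = x)
    (hz : (⟨a, -b⟩ : R) * z = x) : ∃ t : R, x = (p : R) * t := by
  have hpp : Prime (p : ℤ) := Nat.prime_iff_prime_int.1 hp
  have h2 : ¬ (p : ℤ) ∣ 2 := fun h => hp2 ((Nat.prime_dvd_prime_iff_eq hp Nat.prime_two).1
    (by exact_mod_cast h))
  have hab' : a ^ 2 + 2 * (-b) ^ 2 = p := by rw [neg_sq]; exact hab
  have h3 := dvd_conv hab y
  have h4 := dvd_conv hab' z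
  rw [hy] at h3
  rw [hz] at h4
  have h5 : (p : ℤ) ∣ 2 * a * x.im := by
    have := dvd_add h3 h4; ring_nf at this ⊢; exact this
  have h6 : (p : ℤ) ∣ 2 * b * x.re := by
    have := dvd_sub h4 h3; ring_nf at this ⊢; exact this
  have h7 : (p : ℤ) ∣ x.im := by
    rcases hpp.dvd_or_dvd h5 with h | h
    · rcases hpp.dvd_or_dvd h with h | h
      · exact absurd h h2
      · exact absurd h (not_dvd_a hp hp2 hab)
    · exact h
  have h8 : (p : ℤ) ∣ x.re := by
    rcases hpp.dvd_or_dvd h6 with h | h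
    · rcases hpp.dvd_or_dvd h with h | h
      · exact absurd h h2
      · exact absurd h (not_dvd_b hp hab)
    · exact h
  obtain ⟨u, hu⟩ := h8
  obtain ⟨v, hv⟩ := h7
  refine ⟨⟨u, v⟩, ?_⟩
  rw [Zsqrtd.ext_iff]
  simp [hu, hv]

lemma norm_natCast (p : ℕ) : (p : R).norm = p * p := by
  simp [norm_eq, pow_two]

lemma pi_mul {p : ℕ} {a b : ℤ} (hab : a ^ 2 + 2 * b ^ 2 = p) :
    (⟨a, b⟩ : R) * ⟨a, -b⟩ = (p : R) := by
  rw [Zsqrtd.ext_iff]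
  simp only [Zsqrtd.re_mul, Zsqrtd.im_mul, Zsqrtd.re_natCast, Zsqrtd.im_natCast]
  constructor
  · linear_combination hab
  · ring

lemma hecke0 {p : ℕ} (hp : p.Prime) (hp2 : p ≠ 2) {a b : ℤ}
    (hab : a ^ 2 + 2 * b ^ 2 = p) {m : ℕ} (hm : Odd m) (hpm : ¬ p ∣ m) :
    F (p * m) = (ψ ⟨a, b⟩ + ψ ⟨a, -b⟩) * F m := by
  have hab' : a ^ 2 + 2 * (-b) ^ 2 = p := by rw [neg_sq]; exact hab
  have ho := odd_re (hp.odd_of_ne_two hp2) (norm_mk hab)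
  have ho' := odd_re (hp.odd_of_ne_two hp2) (norm_mk hab')
  rw [F, A_split hp hab, Finset.sum_union, sum_image hm _ ho, sum_image hm _ ho']
  · ring
  · rw [Finset.disjoint_left]
    intro x h1 h2
    rw [Finset.mem_image] at h1 h2
    obtain ⟨y, hy, rfl⟩ := h1
    obtain ⟨z, hz, hz'⟩ := h2
    obtain ⟨t, ht⟩ := dvd_both hp hp2 hab rfl hz'
    have h := congrArg Zsqrtd.norm ht
    rw [Zsqrtd.norm_mul, Zsqrtd.norm_mul, norm_mk hab, mem_A.1 hy, norm_natCast, mul_assoc] at h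
    have h0 : (p : ℤ) ≠ 0 := by exact_mod_cast hp.ne_zero
    have h := mul_left_cancel₀ h0 h
    exact hpm (Int.natCast_dvd_natCast.1 ⟨_, h⟩)

lemma hecke1 {p : ℕ} (hp : p.Prime) (hp2 : p ≠ 2) {a b : ℤ}
    (hab : a ^ 2 + 2 * b ^ 2 = p) {m : ℕ} (hm : Odd m) :
    F (p * (p * m)) = (ψ ⟨a, b⟩ + ψ ⟨a, -b⟩) * F (p * m) - ψ ⟨a, b⟩ * ψ ⟨a, -b⟩ * F m := by
  have hab' : a ^ 2 + 2 * (-b) ^ 2 = p := by rw [neg_sq]; exact hab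
  have hpo := hp.odd_of_ne_two hp2
  have ho := odd_re hpo (norm_mk hab)
  have ho' := odd_re hpo (norm_mk hab')
  have hu := Finset.sum_union_inter (f := ψ)
    (s₁ := (A (p * m)).image (fun y => (⟨a, b⟩ : R) * y))
    (s₂ := (A (p * m)).image (fun y => (⟨a, -b⟩ : R) * y))
  rw [← A_split hp hab, sum_image (hpo.mul hm) _ ho, sum_image (hpo.mul hm) _ ho'] at hu
  have hi : (A (p * m)).image (fun y => (⟨a, b⟩ : R) * y) ∩
      (A (p * m)).image (fun y => (⟨a, -b⟩ : R) * y) = (A m).image (fun y => (p : R) * y) := by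
    have h0 : (p : ℤ) ≠ 0 := by exact_mod_cast hp.ne_zero
    ext x
    simp only [Finset.mem_inter, Finset.mem_image, mem_A]
    constructor
    · rintro ⟨⟨y, hy, hy'⟩, ⟨z, hz, hz'⟩⟩
      obtain ⟨t, ht⟩ := dvd_both hp hp2 hab hy' hz'
      refine ⟨t, ?_, ht.symm⟩
      rw [ht] at hy'
      have h := congrArg Zsqrtd.norm hy'
      rw [Zsqrtd.norm_mul, Zsqrtd.norm_mul, norm_mk hab, hy, norm_natCast, mul_assoc] at h
      have h := mul_left_cancel₀ h0 h
      push_cast at h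
      exact (mul_left_cancel₀ h0 h).symm
    · rintro ⟨t, ht, rfl⟩
      refine ⟨⟨⟨a, -b⟩ * t, ?_, ?_⟩, ⟨⟨a, b⟩ * t, ?_, ?_⟩⟩
      · rw [Zsqrtd.norm_mul, norm_mk hab', ht]; push_cast; rfl
      · rw [← mul_assoc, pi_mul hab]
      · rw [Zsqrtd.norm_mul, norm_mk hab, ht]; push_cast; rfl
      · rw [← mul_assoc, mul_comm (⟨a, -b⟩ : R), pi_mul hab]
  have hpr : Odd (p : R).re := by
    rw [Zsqrtd.re_natCast]; exact_mod_cast hpo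
  rw [hi, sum_image hm _ hpr, ← pi_mul hab, ψ_mul _ _ ho ho'] at hu
  rw [F]
  linear_combination hu

lemma pow_ne {p : ℕ} (hp : p.Prime) (hp2 : p ≠ 2) {a b : ℤ}
    (hab : a ^ 2 + 2 * b ^ 2 = p) (k : ℕ) : ψ ⟨a, b⟩ ^ (k + 1) ≠ ψ ⟨a, -b⟩ ^ (k + 1) := by
  intro h
  have hpp : Prime (p : ℤ) := Nat.prime_iff_prime_int.1 hp
  have h4 := congrArg (fun z => z ^ 4) h
  have key : ∀ x : R, (ψ x ^ (k + 1)) ^ 4 = φ (x ^ (8 * (k + 1))) := by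
    intro x
    unfold ψ
    have : (Complex.I ^ (x.re * x.im)) ^ 4 = 1 := by
      rw [← zpow_natCast, ← zpow_mul, mul_comm]
      exact I_zpow_four _
    calc _ = ((Complex.I ^ (x.re * x.im)) ^ 4) ^ (k + 1) * φ x ^ (8 * (k + 1)) := by ring
      _ = _ := by rw [this, one_pow, one_mul, map_pow]
  simp only [key] at h4
  have h5 := φ_inj h4
  have h6 : (⟨a, -b⟩ : R) = ((2 * a : ℤ) : R) - ⟨a, b⟩ := by
    rw [Zsqrtd.ext_iff]
    constructor
    · rw [Zsqrtd.re_sub, Zsqrtd.re_intCast]; ring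
    · rw [Zsqrtd.im_sub, Zsqrtd.im_intCast]; ring
  have h7 : (⟨a, b⟩ : R) ∣ ((2 * a : ℤ) : R) ^ (8 * (k + 1)) := by
    have e1 : (⟨a, b⟩ : R) ∣ (⟨a, -b⟩ : R) ^ (8 * (k + 1)) := by
      rw [← h5]; exact dvd_pow_self _ (by omega)
    have e2 := sub_dvd_pow_sub_pow ((2 * a : ℤ) : R) (⟨a, -b⟩ : R) (8 * (k + 1))
    have e3 : ((2 * a : ℤ) : R) - (⟨a, -b⟩ : R) = ⟨a, b⟩ := by rw [h6]; ring
    rw [e3] at e2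
    have := dvd_add e2 e1
    rwa [sub_add_cancel] at this
  obtain ⟨t, ht⟩ := h7
  have h8 := congrArg Zsqrtd.norm ht
  rw [Zsqrtd.norm_mul, norm_mk hab, ← Int.cast_pow, Zsqrtd.norm_intCast] at h8
  have h9 : (p : ℤ) ∣ 2 * a := by
    rcases hpp.dvd_or_dvd (⟨_, h8⟩ : (p : ℤ) ∣ _) with h | h <;> exact hpp.dvd_of_dvd_pow h
  rcases hpp.dvd_or_dvd h9 with h | h
  · exact hp2 ((Nat.prime_dvd_prime_iff_eq hp Nat.prime_two).1 (by exact_mod_cast h))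
  · exact not_dvd_a hp hp2 hab h

lemma split_pow {p : ℕ} (hp : p.Prime) (hp2 : p ≠ 2) {a b : ℤ}
    (hab : a ^ 2 + 2 * b ^ 2 = p) {m : ℕ} (hm : Odd m) (hpm : ¬ p ∣ m) (k : ℕ) :
    (ψ ⟨a, b⟩ - ψ ⟨a, -b⟩) * F (p ^ k * m) =
      (ψ ⟨a, b⟩ ^ (k + 1) - ψ ⟨a, -b⟩ ^ (k + 1)) * F m := by
  have hpo := hp.odd_of_ne_two hp2
  have main : ∀ k, (ψ ⟨a, b⟩ - ψ ⟨a, -b⟩) * F (p ^ k * m) =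
      (ψ ⟨a, b⟩ ^ (k + 1) - ψ ⟨a, -b⟩ ^ (k + 1)) * F m ∧
      (ψ ⟨a, b⟩ - ψ ⟨a, -b⟩) * F (p ^ (k + 1) * m) =
      (ψ ⟨a, b⟩ ^ (k + 2) - ψ ⟨a, -b⟩ ^ (k + 2)) * F m := by
    intro k
    induction k with
    | zero =>
      simp only [pow_zero, one_mul, zero_add, pow_one, hecke0 hp hp2 hab hm hpm, true_and]
      ring
    | succ k ih =>
      refine ⟨ih.2, ?_⟩
      have e : p ^ (k + 1 + 1) * m = p * (p * (p ^ k * m)) := by ring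
      have e' : p * (p ^ k * m) = p ^ (k + 1) * m := by ring
      rw [e, hecke1 hp hp2 hab ((hpo.pow).mul hm), e']
      linear_combination (ψ ⟨a, b⟩ + ψ ⟨a, -b⟩) * ih.2 - ψ ⟨a, b⟩ * ψ ⟨a, -b⟩ * ih.1
  exact (main k).1

lemma split_iff {p : ℕ} (hp : p.Prime) (h : p % 8 = 1 ∨ p % 8 = 3)
    {m : ℕ} (hm : Odd m) (hpm : ¬ p ∣ m) (k : ℕ) : F (p ^ k * m) = 0 ↔ F m = 0 := by
  have hp2 : p ≠ 2 := by rintro rfl; omega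
  obtain ⟨a, b, hab⟩ := exists_rep p hp h
  have h1 := split_pow hp hp2 hab hm hpm k
  have h2 := sub_ne_zero.2 (pow_ne hp hp2 hab k)
  have h3 := sub_ne_zero.2 (pow_ne hp hp2 hab 0)
  simp only [zero_add, pow_one] at h3
  constructor
  · intro h
    rw [h, mul_zero] at h1
    exact (mul_eq_zero.1 h1.symm).resolve_left h2
  · intro h
    rw [h, mul_zero] at h1
    exact (mul_eq_zero.1 h1).resolve_left h3

lemma inert_dvd {p : ℕ} (hp : p.Prime) (h : p % 8 = 5 ∨ p % 8 = 7) {x : R}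
    (hx : (p : ℤ) ∣ x.norm) : ∃ t : R, x = (p : R) * t := by
  have : Fact p.Prime := ⟨hp⟩
  have hpp : Prime (p : ℤ) := Nat.prime_iff_prime_int.1 hp
  have hp2 : p ≠ 2 := by rintro rfl; omega
  have hns : ¬ IsSquare (-2 : ZMod p) := by
    rw [ZMod.exists_sq_eq_neg_two_iff hp2]; omega
  rw [norm_eq] at hx
  have hy : (p : ℤ) ∣ x.im := by
    rw [← ZMod.intCast_zmod_eq_zero_iff_dvd]
    by_contra hy
    apply hns
    rw [← ZMod.intCast_zmod_eq_zero_iff_dvd] at hx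
    push_cast at hx
    refine ⟨x.re / x.im, ?_⟩
    field_simp
    linear_combination -hx
  have hre : (p : ℤ) ∣ x.re := by
    apply hpp.dvd_of_dvd_pow (n := 2)
    have := dvd_sub hx (dvd_mul_of_dvd_right (dvd_pow hy two_ne_zero) 2)
    rwa [add_sub_cancel_right] at this
  obtain ⟨u, hu⟩ := hre
  obtain ⟨v, hv⟩ := hy
  refine ⟨⟨u, v⟩, ?_⟩
  rw [Zsqrtd.ext_iff]
  simp [hu, hv]

lemma inert0 {p : ℕ} (hp : p.Prime) (h : p % 8 = 5 ∨ p % 8 = 7) {m : ℕ} (hpm : ¬ p ∣ m) :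
    F (p * m) = 0 := by
  have : A (p * m) = ∅ := by
    rw [Finset.eq_empty_iff_forall_notMem]
    intro x hx
    rw [mem_A] at hx
    push_cast at hx
    obtain ⟨t, rfl⟩ := inert_dvd hp h ⟨_, hx⟩
    rw [Zsqrtd.norm_mul, norm_natCast, mul_assoc] at hx
    have h0 : (p : ℤ) ≠ 0 := by exact_mod_cast hp.ne_zero
    have h := mul_left_cancel₀ h0 hx
    exact hpm (Int.natCast_dvd_natCast.1 ⟨_, h.symm⟩)
  rw [F, this, Finset.sum_empty]

lemma inert1 {p : ℕ} (hp : p.Prime) (h : p % 8 = 5 ∨ p % 8 = 7) {m : ℕ} (hm : Odd m) :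
    F (p * (p * m)) = 0 ↔ F m = 0 := by
  have hp2 : p ≠ 2 := by rintro rfl; omega
  have h0 : (p : ℤ) ≠ 0 := by exact_mod_cast hp.ne_zero
  have e : A (p * (p * m)) = (A m).image (fun y => (p : R) * y) := by
    ext x
    simp only [Finset.mem_image, mem_A]
    constructor
    · intro hx
      push_cast at hx
      obtain ⟨t, rfl⟩ := inert_dvd hp h ⟨_, hx⟩
      refine ⟨t, ?_, rfl⟩
      rw [Zsqrtd.norm_mul, norm_natCast, mul_assoc] at hx
      exact mul_left_cancel₀ h0 (mul_left_cancel₀ h0 hx)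
    · rintro ⟨t, ht, rfl⟩
      rw [Zsqrtd.norm_mul, norm_natCast, ht]; push_cast; ring
  have hpr : Odd (p : R).re := by
    rw [Zsqrtd.re_natCast]; exact_mod_cast hp.odd_of_ne_two hp2
  rw [F, e, sum_image hm _ hpr, mul_eq_zero, or_iff_right]
  unfold ψ
  have : φ (p : R) ≠ 0 := by
    rw [map_natCast]; exact_mod_cast hp.ne_zero
  exact mul_ne_zero (zpow_ne_zero _ Complex.I_ne_zero) (pow_ne_zero _ this)

lemma inert_iff {p : ℕ} (hp : p.Prime) (h : p % 8 = 5 ∨ p % 8 = 7)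
    {m : ℕ} (hm : Odd m) (hpm : ¬ p ∣ m) (k : ℕ) :
    F (p ^ k * m) = 0 ↔ (Odd k ∨ F m = 0) := by
  have hp2 : p ≠ 2 := by rintro rfl; omega
  have hpo := hp.odd_of_ne_two hp2
  induction k using Nat.twoStepInduction with
  | zero => simp
  | one => simp [inert0 hp h hpm]
  | more k ih _ =>
    have e : p ^ (k + 2) * m = p * (p * (p ^ k * m)) := by ring
    rw [e, inert1 hp h ((hpo.pow).mul hm)]
    have : Odd (k + 2) ↔ Odd k := by simp [Nat.odd_add]
    rw [this]
    exact ih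

lemma F_iff (n : ℕ) : Odd n → (F n = 0 ↔
    ∃ p : ℕ, p.Prime ∧ (p % 8 = 5 ∨ p % 8 = 7) ∧ Odd (padicValNat p n)) := by
  induction n using Nat.recOnPrimePow with
  | zero => intro h; simp at h
  | one => intro _; simp [F_one]
  | prime_pow_mul a p k hp hpa hk ih =>
    intro ho
    have : Fact p.Prime := ⟨hp⟩
    have hoa : Odd a := (Nat.odd_mul.1 ho).2
    have hop : Odd p := (Nat.odd_pow_iff hk.ne').1 (Nat.odd_mul.1 ho).1
    have ih := ih hoa
    have ha0 : a ≠ 0 := by rintro rfl; simp at hoa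
    have hval : padicValNat p (p ^ k * a) = k := by
      rw [padicValNat.mul (pow_ne_zero _ hp.ne_zero) ha0, padicValNat.prime_pow,
        padicValNat.eq_zero_of_not_dvd hpa, add_zero]
    have hval' : ∀ q : ℕ, q.Prime → q ≠ p →
        padicValNat q (p ^ k * a) = padicValNat q a := by
      intro q hq hqp
      have : Fact q.Prime := ⟨hq⟩
      rw [padicValNat.mul (pow_ne_zero _ hp.ne_zero) ha0, padicValNat.eq_zero_of_not_dvd,
        zero_add]
      intro hd
      exact hqp ((Nat.prime_dvd_prime_iff_eq hq hp).1 (hq.dvd_of_dvd_pow hd))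
    have hvala : padicValNat p a = 0 := padicValNat.eq_zero_of_not_dvd hpa
    by_cases hin : p % 8 = 5 ∨ p % 8 = 7
    · rw [inert_iff hp hin hoa hpa, ih]
      constructor
      · rintro (h | ⟨q, hq, hq8, hqo⟩)
        · exact ⟨p, hp, hin, by rwa [hval]⟩
        · refine ⟨q, hq, hq8, ?_⟩
          rwa [hval' q hq]
          rintro rfl
          rw [hvala] at hqo
          simp at hqo
      · rintro ⟨q, hq, hq8, hqo⟩
        by_cases hqp : q = p
        · left; rwa [hqp, hval] at hqo
        · right; exact ⟨q, hq, hq8, by rwa [hval' q hq hqp] at hqo⟩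
    · have h13 : p % 8 = 1 ∨ p % 8 = 3 := by
        obtain ⟨c, hc⟩ := hop
        omega
      rw [split_iff hp h13 hoa hpa, ih]
      constructor
      · rintro ⟨q, hq, hq8, hqo⟩
        refine ⟨q, hq, hq8, ?_⟩
        rwa [hval' q hq]
        rintro rfl
        exact hin hq8
      · rintro ⟨q, hq, hq8, hqo⟩
        refine ⟨q, hq, hq8, ?_⟩
        rwa [hval' q hq] at hqo
        rintro rfl
        exact hin hq8

/-- the positive solutions -/
def S (n : ℕ) : Finset (ℕ × ℕ) :=
  (Finset.Icc 1 n ×ˢ Finset.Icc 1 n).filter (fun p => p.1 ^ 2 + 2 * p.2 ^ 2 = n)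

lemma both_odd {n a b : ℕ} (h8 : n % 8 = 3) (h : a ^ 2 + 2 * b ^ 2 = n) : Odd a ∧ Odd b := by
  have ha : a % 8 < 8 := Nat.mod_lt _ (by norm_num)
  have hb : b % 8 < 8 := Nat.mod_lt _ (by norm_num)
  have h1 : ((a % 8) ^ 2 + 2 * (b % 8) ^ 2) % 8 = 3 := by
    rw [← h8, ← h]; simp [Nat.add_mod, Nat.mul_mod, Nat.pow_mod]
  rw [Nat.odd_iff, Nat.odd_iff]
  have ea : a % 2 = (a % 8) % 2 := by omega
  have eb : b % 2 = (b % 8) % 2 := by omega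
  rw [ea, eb]
  generalize a % 8 = c at *
  generalize b % 8 = d at *
  interval_cases c <;> interval_cases d <;> simp_all

lemma I_pow_chi {a b : ℕ} (ha : Odd a) (hb : Odd b) :
    Complex.I ^ ((a : ℤ) * b) = Complex.I * ((χm4 a * χm4 b : ℤ) : ℂ) := by
  have h1 : Complex.I ^ ((a : ℤ) * b) = Complex.I ^ (a * b % 4) := by
    rw [← Nat.cast_mul, zpow_natCast]
    conv_lhs => rw [← Nat.div_add_mod (a * b) 4, pow_add, pow_mul, Complex.I_pow_four, one_pow,
      one_mul]
  rw [h1, Nat.mul_mod]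
  unfold χm4
  rw [Nat.odd_iff] at ha hb
  have ha' : a % 4 = 1 ∨ a % 4 = 3 := by omega
  have hb' : b % 4 = 1 ∨ b % 4 = 3 := by omega
  rcases ha' with h | h <;> rcases hb' with h' | h' <;> simp [h, h', pow_succ]

lemma F_eq (n : ℕ) (h8 : n % 8 = 3) :
    F n = 8 * Complex.I * w *
      ((∑ p ∈ S n, χm4 p.1 * χm4 p.2 * p.1 * p.2 : ℤ) : ℂ) := by
  have hmaps : ∀ x ∈ A n, ((x.re.natAbs, x.im.natAbs) : ℕ × ℕ) ∈ S n := by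
    intro x hx
    rw [mem_A, norm_eq, ← Int.natAbs_sq x.re, ← Int.natAbs_sq x.im] at hx
    have hx' : x.re.natAbs ^ 2 + 2 * x.im.natAbs ^ 2 = n := by exact_mod_cast hx
    obtain ⟨h1, h2⟩ := both_odd h8 hx'
    have h1 := h1.pos
    have h2 := h2.pos
    simp only [S, Finset.mem_filter, Finset.mem_product, Finset.mem_Icc]
    refine ⟨⟨⟨h1, ?_⟩, h2, ?_⟩, hx'⟩ <;> nlinarith
  rw [F, ← Finset.sum_fiberwise_of_maps_to hmaps, Int.cast_sum, Finset.mul_sum]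
  refine Finset.sum_congr rfl ?_
  rintro ⟨a, b⟩ hab
  simp only [S, Finset.mem_filter] at hab
  have hab := hab.2
  obtain ⟨ha, hb⟩ := both_odd h8 hab
  have ha0 : (a : ℤ) ≠ 0 := by exact_mod_cast ha.pos.ne'
  have hb0 : (b : ℤ) ≠ 0 := by exact_mod_cast hb.pos.ne'
  have hf : (A n).filter (fun x => ((x.re.natAbs, x.im.natAbs) : ℕ × ℕ) = (a, b)) =
      {(⟨a, b⟩ : R), ⟨-a, -b⟩, ⟨a, -b⟩, ⟨-a, b⟩} := by
    ext x
    simp only [Finset.mem_filter, mem_A, norm_eq, Finset.mem_insert, Finset.mem_singleton,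
      Zsqrtd.ext_iff, Prod.mk.injEq]
    constructor
    · rintro ⟨_, h1, h2⟩
      omega
    · have hz : (a : ℤ) ^ 2 + 2 * (b : ℤ) ^ 2 = n := by exact_mod_cast hab
      rintro (⟨h1, h2⟩ | ⟨h1, h2⟩ | ⟨h1, h2⟩ | ⟨h1, h2⟩) <;> rw [h1, h2] <;>
        refine ⟨?_, by omega, by omega⟩ <;> linarith
  rw [hf, Finset.sum_insert, Finset.sum_insert, Finset.sum_insert, Finset.sum_singleton]
  · have hinv : Complex.I ^ (-((a : ℤ) * b)) = - (Complex.I ^ ((a : ℤ) * b)) := by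
      rw [zpow_neg]
      rw [inv_eq_iff_eq_inv, inv_neg, eq_neg_iff_add_eq_zero]
      have h0 : Complex.I ^ ((a : ℤ) * b) ≠ 0 := zpow_ne_zero _ Complex.I_ne_zero
      have hs : Complex.I ^ ((a : ℤ) * b) * Complex.I ^ ((a : ℤ) * b) = -1 := by
        rw [← mul_zpow, Complex.I_mul_I]
        apply Odd.neg_one_zpow
        exact_mod_cast ha.mul hb
      field_simp
      linear_combination hs
    simp only [ψ, φ_apply, mul_neg, neg_mul, neg_neg, hinv, I_pow_chi ha hb]
    push_cast
    ring
  all_goals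
    simp only [Finset.mem_insert, Finset.mem_singleton, Zsqrtd.ext_iff]
    omega

end G7

theorem g7_coeff_vanishing (n : ℕ) (hn : 0 < n) (h8 : n % 8 = 3) :
    ∑ p ∈ (Finset.Icc 1 n ×ˢ Finset.Icc 1 n).filter (fun p => p.1 ^ 2 + 2 * p.2 ^ 2 = n), χm4 p.1 * χm4 p.2 * p.1 * p.2 = 0 ↔
    ∃ p : ℕ, p.Prime ∧ (p % 8 = 5 ∨ p % 8 = 7) ∧ Odd (padicValNat p n) := by
  rw [← G7.F_iff n (Nat.odd_iff.2 (by omega)), G7.F_eq n h8]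
  have hw : G7.w ≠ 0 := by
    intro h
    have := G7.w_sq
    rw [h] at this
    norm_num at this
  have hc : 8 * Complex.I * G7.w ≠ 0 :=
    mul_ne_zero (mul_ne_zero (by norm_num) Complex.I_ne_zero) hw
  rw [mul_eq_zero, or_iff_right hc, Int.cast_eq_zero]
  rfl
end

section
/- For every positive integer n with n ≡ 3 (mod 8), the sum Σ over pairs of positive integers (m₁,m₂) with m₁²+2m₂² = n of (m₁²−2m₂²) equals 0 if and only if there exists a prime p with p ≡ 5 (mod 8) or p ≡ 7 (mod 8) such that ord_p(n) is odd. -/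
open Finset

/-- all integer representations of `n` by `x^2+2y^2` -/
noncomputable def repSet (n : ℕ) : Finset (ℤ × ℤ) :=
  (Finset.Icc (-(n:ℤ)) n ×ˢ Finset.Icc (-(n:ℤ)) n).filter (fun q => q.1 ^ 2 + 2 * q.2 ^ 2 = (n:ℤ))

noncomputable def repSum (n : ℕ) : ℤ := ∑ q ∈ repSet n, (q.1 ^ 2 - 2 * q.2 ^ 2)

lemma mem_repSet (n : ℕ) (q : ℤ × ℤ) : q ∈ repSet n ↔ q.1 ^ 2 + 2 * q.2 ^ 2 = (n:ℤ) := by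
  unfold repSet
  simp only [Finset.mem_filter, Finset.mem_product, Finset.mem_Icc, and_iff_right_iff_imp]
  intro h
  have h1 := Int.le_self_sq q.1
  have h2 := Int.le_self_sq (-q.1)
  have h3 := Int.le_self_sq q.2
  have h4 := Int.le_self_sq (-q.2)
  rw [neg_sq] at h2 h4
  have := sq_nonneg q.1
  have := sq_nonneg q.2
  refine ⟨⟨?_, ?_⟩, ?_, ?_⟩ <;> linarith

lemma sum_even_Icc (g : ℤ → ℤ) (hg : ∀ x, g (-x) = g x) (n : ℕ) :
    ∑ x ∈ Finset.Icc (-(n:ℤ)) n, g x = g 0 + 2 * ∑ k ∈ Finset.Icc 1 n, g (k:ℤ) := by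
  induction n with
  | zero => simp
  | succ n ih =>
    have e : Finset.Icc (-((n+1:ℕ):ℤ)) ((n+1:ℕ):ℤ)
        = insert (-((n+1:ℕ):ℤ)) (insert ((n+1:ℕ):ℤ) (Finset.Icc (-(n:ℤ)) n)) := by
      ext x; simp only [Finset.mem_insert, Finset.mem_Icc]; omega
    rw [e, Finset.sum_insert, Finset.sum_insert, ih, Finset.sum_Icc_succ_top (by omega), hg]
    · ring
    · simp
    · simp only [Finset.mem_insert, Finset.mem_Icc]; omega

lemma repSum_eq (n : ℕ) (h8 : n % 8 = 3) :
    repSum n = 4 * ∑ p ∈ (Finset.Icc 1 n ×ˢ Finset.Icc 1 n).filter (fun p => p.1 ^ 2 + 2 * p.2 ^ 2 = n), ((p.1 : ℤ) ^ 2 - 2 * (p.2 : ℤ) ^ 2) := by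
  unfold repSum repSet
  rw [Finset.sum_filter, Finset.sum_product, Finset.sum_filter, Finset.sum_product]
  have z1 : ∀ y : ℤ, ¬ ((0:ℤ)^2 + 2 * y^2 = n) := by
    intro y h; have : (n:ℤ) % 8 = 3 := by omega
    omega
  have z2 : ∀ y : ℤ, ¬ (y^2 + 2 * (0:ℤ)^2 = n) := by
    intro y h
    have h3 : y^2 % 8 = 3 := by omega
    have : y % 8 = 0 ∨ y % 8 = 1 ∨ y % 8 = 2 ∨ y % 8 = 3 ∨ y % 8 = 4 ∨ y % 8 = 5 ∨ y % 8 = 6 ∨ y % 8 = 7 := by omega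
    rcases this with h | h | h | h | h | h | h | h <;> simp [pow_two, Int.mul_emod, h] at h3
  rw [sum_even_Icc (fun x => ∑ y ∈ Finset.Icc (-(n:ℤ)) n, if x ^ 2 + 2 * y ^ 2 = (n:ℤ) then (x ^ 2 - 2 * y ^ 2) else 0)]
  · have e : ∀ x : ℤ, ∑ y ∈ Finset.Icc (-(n:ℤ)) n, (if x ^ 2 + 2 * y ^ 2 = (n:ℤ) then (x ^ 2 - 2 * y ^ 2) else 0) = 2 * ∑ y ∈ Finset.Icc 1 n, (if x ^ 2 + 2 * (y:ℤ) ^ 2 = (n:ℤ) then (x ^ 2 - 2 * (y:ℤ) ^ 2) else 0) := by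
      intro x
      rw [sum_even_Icc (fun y => if x ^ 2 + 2 * y ^ 2 = (n:ℤ) then (x ^ 2 - 2 * y ^ 2) else 0)]
      · rw [if_neg (z2 x), zero_add]
      · intro y; simp only [neg_sq]
    simp only [e]
    rw [← Finset.mul_sum, Finset.sum_eq_zero (s := Finset.Icc 1 n) (f := fun y : ℕ => if (0:ℤ) ^ 2 + 2 * (y:ℤ) ^ 2 = (n:ℤ) then ((0:ℤ) ^ 2 - 2 * (y:ℤ) ^ 2) else 0)]
    · have : ∀ x y : ℕ, ((x:ℤ)^2 + 2 * (y:ℤ)^2 = (n:ℤ)) ↔ (x^2+2*y^2 = n) := by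
        intro x y; norm_cast
      simp only [this]
      ring
    · intro y _; rw [if_neg (z1 y)]
  · intro x; simp only [neg_sq]

/-- p is inert : p ∣ norm forces p ∣ both -/
lemma inert_dvd (p : ℕ) (hp : p.Prime) (h : p % 8 = 5 ∨ p % 8 = 7) (x y : ℤ)
    (hd : (p:ℤ) ∣ x^2 + 2*y^2) : (p:ℤ) ∣ x ∧ (p:ℤ) ∣ y := by
  have := Fact.mk hp
  have hp2 : p ≠ 2 := by rintro rfl; omega
  have hns : ¬ IsSquare (-2 : ZMod p) := by
    rw [ZMod.exists_sq_eq_neg_two_iff hp2]; omega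
  have hz : (x : ZMod p)^2 + 2 * (y : ZMod p)^2 = 0 := by
    have := (ZMod.intCast_zmod_eq_zero_iff_dvd _ p).2 hd
    push_cast at this; exact this
  have hy : (y : ZMod p) = 0 := by
    by_contra hy
    apply hns
    refine ⟨(x : ZMod p) / y, ?_⟩
    field_simp
    linear_combination -hz
  have hx : (x : ZMod p) = 0 := by
    rw [hy] at hz; simpa using hz
  exact ⟨(ZMod.intCast_zmod_eq_zero_iff_dvd _ p).1 hx, (ZMod.intCast_zmod_eq_zero_iff_dvd _ p).1 hy⟩

lemma inert_even (p : ℕ) (hp : p.Prime) (h : p % 8 = 5 ∨ p % 8 = 7) : ∀ n : ℕ, 0 < n → ∀ x y : ℤ,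
    x^2 + 2*y^2 = n → Even (padicValNat p n) := by
  have := Fact.mk hp
  intro n
  induction n using Nat.strong_induction_on with
  | _ n ih =>
    intro hn x y hxy
    by_cases hd : p ∣ n
    · obtain ⟨⟨x', rfl⟩, ⟨y', rfl⟩⟩ := inert_dvd p hp h x y (by rw [hxy]; exact_mod_cast hd)
      have hp0 : (p:ℤ) ≠ 0 := by exact_mod_cast hp.ne_zero
      have h2 : ((p:ℤ)^2) ∣ n := ⟨x'^2 + 2 * y'^2, by rw [← hxy]; ring⟩
      obtain ⟨m, rfl⟩ : p^2 ∣ n := by exact_mod_cast h2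
      have hm : 0 < m := Nat.pos_of_mul_pos_left hn
      have h4 : 2^2 ≤ p^2 := Nat.pow_le_pow_left hp.two_le 2
      have hlt : m < p^2*m := by nlinarith
      have := ih m hlt hm x' y' (by
        apply mul_left_cancel₀ (pow_ne_zero 2 hp0)
        push_cast at hxy; linear_combination hxy)
      rw [padicValNat.mul (pow_ne_zero 2 hp.ne_zero) (by omega), padicValNat.prime_pow]
      exact (by decide : Even 2).add this
    · rw [padicValNat.eq_zero_of_not_dvd hd]; exact Even.zero

lemma repSum_inert (p : ℕ) (hp : p.Prime) (h : p % 8 = 5 ∨ p % 8 = 7) (m : ℕ) :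
    repSum (p^2*m) = p^2 * repSum m := by
  have hp0 : (p:ℤ) ≠ 0 := by exact_mod_cast hp.ne_zero
  have : repSet (p^2*m) = (repSet m).image (fun q => ((p:ℤ)*q.1, (p:ℤ)*q.2)) := by
    ext ⟨x, y⟩
    simp only [Finset.mem_image, mem_repSet, Prod.mk.injEq, Prod.exists]
    push_cast
    constructor
    · intro hxy
      obtain ⟨⟨x', rfl⟩, ⟨y', rfl⟩⟩ := inert_dvd p hp h x y (by rw [hxy]; exact ⟨p*m, by ring⟩)
      refine ⟨x', y', ?_, rfl, rfl⟩
      apply mul_left_cancel₀ (pow_ne_zero 2 hp0)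
      linear_combination hxy
    · rintro ⟨x', y', h, rfl, rfl⟩
      rw [← h]; ring
  unfold repSum
  rw [this, Finset.sum_image, Finset.mul_sum]
  · exact Finset.sum_congr rfl fun q _ => by ring
  · rintro ⟨a, b⟩ _ ⟨c, d⟩ _ hh
    simp only [Prod.mk.injEq] at hh ⊢
    exact ⟨mul_left_cancel₀ hp0 hh.1, mul_left_cancel₀ hp0 hh.2⟩

lemma thue (p : ℕ) (hp : p.Prime) (t : ℤ) : ∃ x y : ℤ, (x ≠ 0 ∨ y ≠ 0) ∧ x^2 < p ∧ y^2 < p ∧ (p:ℤ) ∣ x - t * y := by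
  set s := Nat.sqrt p with hs
  have hsq : s * s < p := by
    apply lt_of_le_of_ne (Nat.sqrt_le p)
    intro h
    exact (Nat.prime_iff.1 hp).not_isSquare ⟨s, h.symm⟩
  have hlt : p < (s+1)*(s+1) := Nat.lt_succ_sqrt p
  have := Fact.mk hp
  let f : ℕ × ℕ → ZMod p := fun q => (q.1 : ZMod p) - (t : ZMod p) * q.2
  obtain ⟨a, ha, b, hb, hab, hf⟩ := Finset.exists_ne_map_eq_of_card_lt_of_maps_to
    (s := Finset.range (s+1) ×ˢ Finset.range (s+1)) (t := (Finset.univ : Finset (ZMod p))) (f := f)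
    (by simpa [ZMod.card] using hlt) (by intro x _; simp)
  simp only [Finset.mem_product, Finset.mem_range] at ha hb
  have hb' : ∀ u v : ℕ, u < s+1 → v < s+1 → ((u:ℤ) - v)^2 < p := by
    intro u v hu hv
    have h1 : (s:ℤ)*s < p := by exact_mod_cast hsq
    have : ((u:ℤ) - v)^2 ≤ s^2 := by
      apply sq_le_sq'  <;> omega
    nlinarith
  refine ⟨(a.1:ℤ) - b.1, (a.2:ℤ) - b.2, ?_, hb' _ _ ha.1 hb.1, hb' _ _ ha.2 hb.2, ?_⟩
  · by_contra hc
    push Not at hc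
    exact hab (Prod.ext (by omega) (by omega))
  · rw [← ZMod.intCast_zmod_eq_zero_iff_dvd]
    push_cast
    simp only [f] at hf
    linear_combination hf

lemma split_rep (p : ℕ) (hp : p.Prime) (h : p % 8 = 1 ∨ p % 8 = 3) : ∃ a b : ℤ, a^2 + 2*b^2 = p := by
  have := Fact.mk hp
  have hp2 : p ≠ 2 := by rintro rfl; omega
  obtain ⟨r, hr⟩ := (ZMod.exists_sq_eq_neg_two_iff hp2).2 h
  obtain ⟨t, rfl⟩ := ZMod.intCast_surjective r
  have ht : (p:ℤ) ∣ t^2 + 2 := by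
    rw [← ZMod.intCast_zmod_eq_zero_iff_dvd]; push_cast; linear_combination -hr
  obtain ⟨x, y, h0, hx, hy, hd⟩ := thue p hp t
  have hpp : (0:ℤ) < p := by exact_mod_cast hp.pos
  have hN : (p:ℤ) ∣ x^2 + 2*y^2 := by
    have : x^2+2*y^2 = (x - t*y)*(x+t*y) + (t^2+2)*y^2 := by ring
    rw [this]; exact dvd_add (hd.mul_right _) (ht.mul_right _)
  obtain ⟨k, hk⟩ := hN
  have hpos : 0 < x^2+2*y^2 := by
    rcases h0 with h0 | h0 <;> positivity
  have hk0 : 0 < k := by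
    by_contra hc; push Not at hc; nlinarith
  have hk3 : k < 3 := by
    by_contra hc; push Not at hc; nlinarith
  obtain rfl | rfl : k = 1 ∨ k = 2 := by omega
  · exact ⟨x, y, by linarith⟩
  · have : Even (x^2) := ⟨p - y^2, by linarith⟩
    have hxe : Even x := by simpa [Int.even_pow] using this
    obtain ⟨z, rfl⟩ := hxe
    exact ⟨y, z, by linarith⟩

lemma split_facts (p : ℕ) (hp : p.Prime) (hodd : p % 2 = 1) (a b : ℤ) (hab : a^2 + 2*b^2 = p) :
    ¬ (p:ℤ) ∣ a ∧ ¬ (p:ℤ) ∣ b := by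
  have hpI : Prime (p:ℤ) := Nat.prime_iff_prime_int.1 hp
  have h2 : ¬ (p:ℤ) ∣ 2 := by
    intro h
    have h' : p ∣ 2 := by exact_mod_cast h
    have := Nat.le_of_dvd (by norm_num) h'
    have := hp.two_le
    omega
  have key : ¬ ((p:ℤ) ∣ a ∧ (p:ℤ) ∣ b) := by
    rintro ⟨⟨x, rfl⟩, ⟨y, rfl⟩⟩
    have : (p:ℤ) * (p * (x^2 + 2*y^2)) = p * 1 := by linear_combination hab
    have := mul_left_cancel₀ hpI.ne_zero this
    exact hpI.not_isUnit (IsUnit.of_mul_eq_one _ this)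
  constructor
  · intro ha
    apply key ⟨ha, ?_⟩
    have : (p:ℤ) ∣ 2 * b^2 := by
      have e : 2*b^2 = p - a * a := by linear_combination hab
      rw [e]; exact dvd_sub dvd_rfl (ha.mul_right _)
    rcases hpI.dvd_or_dvd this with h | h
    · exact absurd h h2
    · exact hpI.dvd_of_dvd_pow h
  · intro hb
    apply key ⟨?_, hb⟩
    have : (p:ℤ) ∣ a^2 := by
      have e : a^2 = p - b * (2*b) := by linear_combination hab
      rw [e]; exact dvd_sub dvd_rfl (hb.mul_right _)
    exact hpI.dvd_of_dvd_pow this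

/-- multiplication by `a + b √-2` -/
def mulMap (a b : ℤ) (q : ℤ × ℤ) : ℤ × ℤ := (a * q.1 - 2 * b * q.2, a * q.2 + b * q.1)

lemma mulMap_inj (p : ℕ) (hp : p.Prime) (a b : ℤ) (hab : a^2 + 2*b^2 = p) :
    Function.Injective (mulMap a b) := by
  have hp0 : (p:ℤ) ≠ 0 := by exact_mod_cast hp.ne_zero
  rintro ⟨x, y⟩ ⟨z, w⟩ h
  simp only [mulMap, Prod.mk.injEq] at h ⊢
  obtain ⟨h1, h2⟩ := h
  constructor
  · apply mul_left_cancel₀ hp0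
    rw [← hab]; linear_combination a * h1 + 2 * b * h2
  · apply mul_left_cancel₀ hp0
    rw [← hab]; linear_combination a * h2 - b * h1

lemma mem_image_mulMap (p : ℕ) (hp : p.Prime) (a b : ℤ) (hab : a^2 + 2*b^2 = p) (m : ℕ) (x y : ℤ) :
    (x, y) ∈ (repSet m).image (mulMap a b) ↔ (x^2+2*y^2 = p * m ∧ (p:ℤ) ∣ a*y - b*x) := by
  have hpI : Prime (p:ℤ) := Nat.prime_iff_prime_int.1 hp
  have hp0 := hpI.ne_zero
  simp only [Finset.mem_image, mem_repSet, mulMap, Prod.mk.injEq, Prod.exists]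
  constructor
  · rintro ⟨z, w, h, rfl, rfl⟩
    refine ⟨?_, w, ?_⟩
    · rw [← h, ← hab]; ring
    · rw [← hab]; ring
  · rintro ⟨h, w, hw⟩
    have h1 : (p:ℤ) ∣ (a*x+2*b*y)^2 := by
      have : (a*x+2*b*y)^2 = p * (p*m) - 2 * (p*w)^2 := by
        rw [← hw, ← h]; nth_rw 1 [← hab]; ring
      exact ⟨p*m - 2*p*w^2, by rw [this]; ring⟩
    obtain ⟨z, hz⟩ := hpI.dvd_of_dvd_pow h1
    have ex : a*z - 2*b*w = x := by
      apply mul_left_cancel₀ hp0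
      linear_combination -a*hz + 2*b*hw + x * hab
    have ey : a*w + b*z = y := by
      apply mul_left_cancel₀ hp0
      linear_combination -b*hz - a*hw + y * hab
    refine ⟨z, w, ?_, ex, ey⟩
    apply mul_left_cancel₀ hp0
    rw [← h, ← ex, ← ey, ← hab]; ring

lemma hecke (p : ℕ) (hp : p.Prime) (a b : ℤ) (hab : a^2 + 2*b^2 = p) (m : ℕ) :
    repSum (p*m) = 2*(a^2-2*b^2) * repSum m
      - ∑ q ∈ (repSet m).image (mulMap a b) ∩ (repSet m).image (mulMap a (-b)), (q.1^2 - 2*q.2^2) := by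
  have hpI : Prime (p:ℤ) := Nat.prime_iff_prime_int.1 hp
  have hab' : a^2 + 2*(-b)^2 = p := by rw [neg_sq]; exact hab
  have hU : repSet (p*m) = (repSet m).image (mulMap a b) ∪ (repSet m).image (mulMap a (-b)) := by
    ext ⟨x, y⟩
    rw [Finset.mem_union, mem_image_mulMap p hp a b hab, mem_image_mulMap p hp a (-b) hab', mem_repSet,
      ← and_or_left]
    push_cast
    refine ⟨fun h => ⟨h, ?_⟩, fun h => h.1⟩
    apply hpI.dvd_or_dvd
    exact ⟨y^2 - b^2*m, by linear_combination y^2 * hab - b^2 * h⟩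
  have := Finset.sum_union_inter (s₁ := (repSet m).image (mulMap a b))
    (s₂ := (repSet m).image (mulMap a (-b))) (f := fun q => q.1^2 - 2*q.2^2)
  rw [← hU, Finset.sum_image (fun x _ y _ h => mulMap_inj p hp a b hab h),
    Finset.sum_image (fun x _ y _ h => mulMap_inj p hp a (-b) hab' h), ← Finset.sum_add_distrib] at this
  unfold repSum
  rw [eq_sub_iff_add_eq, this, Finset.mul_sum]
  refine Finset.sum_congr rfl fun q _ => ?_
  simp only [mulMap]; ring

lemma mem_inter (p : ℕ) (hp : p.Prime) (hodd : p % 2 = 1) (a b : ℤ) (hab : a^2 + 2*b^2 = p) (m : ℕ) (x y : ℤ) :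
    (x, y) ∈ (repSet m).image (mulMap a b) ∩ (repSet m).image (mulMap a (-b)) ↔
      (x^2+2*y^2 = p * m ∧ (p:ℤ) ∣ x ∧ (p:ℤ) ∣ y) := by
  have hpI : Prime (p:ℤ) := Nat.prime_iff_prime_int.1 hp
  have hab' : a^2 + 2*(-b)^2 = p := by rw [neg_sq]; exact hab
  obtain ⟨ha, hb⟩ := split_facts p hp hodd a b hab
  have h2 : ¬ (p:ℤ) ∣ 2 := by
    intro h
    have h' : p ∣ 2 := by exact_mod_cast h
    have := Nat.le_of_dvd (by norm_num) h'
    have := hp.two_le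
    omega
  rw [Finset.mem_inter, mem_image_mulMap p hp a b hab, mem_image_mulMap p hp a (-b) hab']
  constructor
  · rintro ⟨⟨h, d1⟩, _, d2⟩
    refine ⟨h, ?_, ?_⟩
    · have : (p:ℤ) ∣ 2 * (b * x) := by
        have := dvd_sub d2 d1
        ring_nf at this ⊢; exact this
      exact ((hpI.dvd_or_dvd ((hpI.dvd_or_dvd this).resolve_left h2))).resolve_left hb
    · have : (p:ℤ) ∣ 2 * (a * y) := by
        have := dvd_add d2 d1
        ring_nf at this ⊢; exact this
      exact ((hpI.dvd_or_dvd ((hpI.dvd_or_dvd this).resolve_left h2))).resolve_left ha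
  · rintro ⟨h, dx, dy⟩
    exact ⟨⟨h, dvd_sub (dy.mul_left _) (dx.mul_left _)⟩, h, dvd_sub (dy.mul_left _) (dx.mul_left _)⟩

lemma hecke_coprime (p : ℕ) (hp : p.Prime) (hodd : p % 2 = 1) (a b : ℤ) (hab : a^2 + 2*b^2 = p)
    (m : ℕ) (hm : ¬ p ∣ m) : repSum (p*m) = 2*(a^2-2*b^2) * repSum m := by
  have hp0 : (p:ℤ) ≠ 0 := by exact_mod_cast hp.ne_zero
  rw [hecke p hp a b hab]
  rw [Finset.sum_eq_zero, sub_zero]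
  rintro ⟨x, y⟩ hq
  exfalso
  rw [mem_inter p hp hodd a b hab] at hq
  obtain ⟨h, ⟨z, rfl⟩, ⟨w, rfl⟩⟩ := hq
  apply hm
  have : (p:ℤ) * (p * (z^2+2*w^2)) = p * m := by linear_combination h
  have := mul_left_cancel₀ hp0 this
  have h' : (p:ℤ) ∣ m := ⟨_, this.symm⟩
  exact_mod_cast h'

lemma hecke_dvd (p : ℕ) (hp : p.Prime) (hodd : p % 2 = 1) (a b : ℤ) (hab : a^2 + 2*b^2 = p)
    (m : ℕ) : repSum (p*(p*m)) = 2*(a^2-2*b^2) * repSum (p*m) - p^2 * repSum m := by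
  have hp0 : (p:ℤ) ≠ 0 := by exact_mod_cast hp.ne_zero
  rw [hecke p hp a b hab]
  congr 1
  have : (repSet (p*m)).image (mulMap a b) ∩ (repSet (p*m)).image (mulMap a (-b))
      = (repSet m).image (fun q => ((p:ℤ)*q.1, (p:ℤ)*q.2)) := by
    ext ⟨x, y⟩
    rw [mem_inter p hp hodd a b hab]
    simp only [Finset.mem_image, mem_repSet, Prod.mk.injEq, Prod.exists]
    push_cast
    constructor
    · rintro ⟨h, ⟨z, rfl⟩, ⟨w, rfl⟩⟩
      refine ⟨z, w, ?_, rfl, rfl⟩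
      apply mul_left_cancel₀ (pow_ne_zero 2 hp0)
      linear_combination h
    · rintro ⟨z, w, h, rfl, rfl⟩
      exact ⟨by rw [← h]; ring, dvd_mul_right _ _, dvd_mul_right _ _⟩
  unfold repSum
  rw [this, Finset.sum_image, Finset.mul_sum]
  · exact Finset.sum_congr rfl fun q _ => by ring
  · rintro ⟨a, b⟩ _ ⟨c, d⟩ _ hh
    simp only [Prod.mk.injEq] at hh ⊢
    exact ⟨mul_left_cancel₀ hp0 hh.1, mul_left_cancel₀ hp0 hh.2⟩

lemma split_pow (p : ℕ) (hp : p.Prime) (h : p % 8 = 1 ∨ p % 8 = 3) (m : ℕ) (hm : ¬ p ∣ m) (k : ℕ) :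
    ∃ u v : ℤ, ¬ (p:ℤ) ∣ u ∧ ¬ (p:ℤ) ∣ v ∧ repSum (p^k*m) = u * repSum m ∧
      repSum (p^(k+1)*m) = v * repSum m := by
  have hpI : Prime (p:ℤ) := Nat.prime_iff_prime_int.1 hp
  have hodd : p % 2 = 1 := by omega
  obtain ⟨a, b, hab⟩ := split_rep p hp h
  obtain ⟨ha, hb⟩ := split_facts p hp hodd a b hab
  have hc : ¬ (p:ℤ) ∣ 2*(a^2-2*b^2) := by
    intro hd
    have h4 : (p:ℤ) ∣ 2 * 2 * a^2 := by
      have e : 2 * 2 * a^2 = 2*(a^2-2*b^2) + p * 2 := by rw [← hab]; ring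
      rw [e]; exact dvd_add hd (dvd_mul_right _ _)
    have h2 : ¬ (p:ℤ) ∣ 2 := by
      intro h
      have h' : p ∣ 2 := by exact_mod_cast h
      have := Nat.le_of_dvd (by norm_num) h'
      have := hp.two_le
      omega
    rcases hpI.dvd_or_dvd h4 with h | h
    · rcases hpI.dvd_or_dvd h with h | h <;> exact h2 h
    · exact ha (hpI.dvd_of_dvd_pow h)
  induction k with
  | zero =>
    refine ⟨1, 2*(a^2-2*b^2), fun h => hpI.not_isUnit (isUnit_of_dvd_one h), hc, by simp, ?_⟩
    rw [zero_add, pow_one]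
    exact hecke_coprime p hp hodd a b hab m hm
  | succ k ih =>
    obtain ⟨u, v, hu, hv, e1, e2⟩ := ih
    refine ⟨v, 2*(a^2-2*b^2) * v - p^2*u, hv, ?_, e2, ?_⟩
    · intro hd
      have : (p:ℤ) ∣ 2*(a^2-2*b^2) * v := by
        have := dvd_add hd (Dvd.intro (p*u) rfl : (p:ℤ) ∣ p * (p * u))
        have e : 2*(a^2-2*b^2) * v - p^2*u + p * (p*u) = 2*(a^2-2*b^2) * v := by ring
        rwa [e] at this
      exact (hpI.dvd_or_dvd this).elim hc hv
    · have e : p^(k+1+1)*m = p*(p*(p^k*m)) := by ring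
      rw [e, hecke_dvd p hp hodd a b hab, e1]
      have e' : p*(p^k*m) = p^(k+1)*m := by ring
      rw [e', e2]; ring

lemma inert_pow (p : ℕ) (hp : p.Prime) (h : p % 8 = 5 ∨ p % 8 = 7) (m : ℕ) (k : ℕ) :
    repSum (p^(k+k)*m) = p^(k+k) * repSum m := by
  induction k with
  | zero => simp
  | succ k ih =>
    have e : p^(k+1+(k+1))*m = p^2*(p^(k+k)*m) := by ring
    rw [e, repSum_inert p hp h, ih]; ring

lemma repSum_ne_zero : ∀ n : ℕ, n % 2 = 1 →
    (∀ p : ℕ, p.Prime → (p % 8 = 5 ∨ p % 8 = 7) → Even (padicValNat p n)) → repSum n ≠ 0 := by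
  intro n
  induction n using Nat.strong_induction_on with
  | _ n ih =>
    intro hodd hE
    by_cases h1 : n = 1
    · subst h1
      have e : repSet 1 = {((1:ℤ), (0:ℤ)), (-1, 0)} := by
        ext ⟨x, y⟩
        rw [mem_repSet]
        simp only [Finset.mem_insert, Finset.mem_singleton, Prod.mk.injEq]
        constructor
        · intro h
          push_cast at h
          have hy : y = 0 := by
            by_contra hy
            have : 0 < y^2 := by positivity
            nlinarith [sq_nonneg x]
          subst hy
          have hx : x^2 = 1 := by linarith
          rcases (by simpa using hx : x = 1 ∨ x = -1) with h | h <;> simp [h]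
        · rintro (⟨rfl, rfl⟩ | ⟨rfl, rfl⟩) <;> norm_num
      unfold repSum
      rw [e, Finset.sum_pair (by simp)]
      norm_num
    · have hp := Nat.minFac_prime h1
      set p := n.minFac with hpdef
      have hpn : p ∣ n := Nat.minFac_dvd n
      obtain ⟨k, m, hm, hnk⟩ := Nat.exists_eq_pow_mul_and_not_dvd (by omega : n ≠ 0) p hp.ne_one
      have hk : k ≠ 0 := by
        rintro rfl
        rw [pow_zero, one_mul] at hnk
        exact hm (hnk ▸ hpn)
      have hpo : p % 2 = 1 := by
        obtain ⟨c, hc⟩ := hpn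
        rcases Nat.mod_two_eq_zero_or_one p with h | h
        · rw [hc, Nat.mul_mod, h] at hodd; simp at hodd
        · exact h
      have hmo : m % 2 = 1 := by
        rcases Nat.mod_two_eq_zero_or_one m with h | h
        · rw [hnk, Nat.mul_mod, h] at hodd; simp at hodd
        · exact h
      have hlt : m < n := by
        rw [hnk]
        have : 1 < p^k := Nat.one_lt_pow hk hp.one_lt
        nlinarith [(by omega : 0 < m)]
      have hval : ∀ q : ℕ, q.Prime → padicValNat q n = k * padicValNat q p + padicValNat q m := by
        intro q hq
        have := Fact.mk hq
        rw [hnk, padicValNat.mul (pow_ne_zero _ hp.ne_zero) (by omega), padicValNat.pow]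
      have hEm : ∀ q : ℕ, q.Prime → (q % 8 = 5 ∨ q % 8 = 7) → Even (padicValNat q m) := by
        intro q hq hq8
        by_cases hqp : q = p
        · rw [hqp, padicValNat.eq_zero_of_not_dvd hm]; exact Even.zero
        · have h := hE q hq hq8
          rw [hval q hq, padicValNat.eq_zero_of_not_dvd (n := p)
            (fun hd => hqp ((Nat.prime_dvd_prime_iff_eq hq hp).1 hd)), mul_zero, zero_add] at h
          exact h
      have ihm := ih m hlt hmo hEm
      by_cases h8 : p % 8 = 5 ∨ p % 8 = 7
      · have h := hE p hp h8
        have := Fact.mk hp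
        rw [hval p hp, padicValNat.eq_zero_of_not_dvd hm, padicValNat_self, mul_one, add_zero] at h
        obtain ⟨j, hj⟩ := h
        rw [hnk, hj, inert_pow p hp h8]
        exact mul_ne_zero (pow_ne_zero _ (by exact_mod_cast hp.ne_zero)) ihm
      · obtain ⟨u, v, hu, _, e, _⟩ := split_pow p hp (by omega) m hm k
        rw [hnk, e]
        exact mul_ne_zero (by rintro rfl; exact hu (dvd_zero _)) ihm

theorem g8_coeff_vanishing (n : ℕ) (hn : 0 < n) (h8 : n % 8 = 3) :
    ∑ p ∈ (Finset.Icc 1 n ×ˢ Finset.Icc 1 n).filter (fun p => p.1 ^ 2 + 2 * p.2 ^ 2 = n), ((p.1 : ℤ) ^ 2 - 2 * (p.2 : ℤ) ^ 2) = 0 ↔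
    ∃ p : ℕ, p.Prime ∧ (p % 8 = 5 ∨ p % 8 = 7) ∧ Odd (padicValNat p n) := by
  constructor
  · intro hS
    by_contra hc
    apply repSum_ne_zero n (by omega)
    · intro p hp hp8
      by_contra ho
      exact hc ⟨p, hp, hp8, Nat.not_even_iff_odd.1 ho⟩
    · rw [repSum_eq n h8, hS, mul_zero]
  · rintro ⟨p, hp, hp8, ho⟩
    apply Finset.sum_eq_zero
    rintro ⟨x, y⟩ hq
    exfalso
    rw [Finset.mem_filter] at hq
    exact Nat.not_even_iff_odd.2 ho (inert_even p hp hp8 n hn x y (by exact_mod_cast hq.2))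
end
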